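/- arXiv:1909.02610 — 3 statements merged into one kernel-verified Lean document; each statement's English description precedes it below -/
import Mathlib

section
/- Let n ≥ 3. If n ≡ 0 or 2 (mod 3), then depth(S_{n,3}/I(C_{n,3})) = sdepth(S_{n,3}/I(C_{n,3})) = ⌈(n−1)/3⌉. If n ≡ 1 (mod 3), then ⌈(n−1)/3⌉ ≤ depth(S_{n,3}/I(C_{n,3})) ≤ ⌈n/3⌉ and ⌈(n−1)/3⌉ ≤ sdepth(S_{n,3}/I(C_{n,3})) ≤ ⌈n/3⌉. -/
open MvPolynomial

section Defs

variable (K : Type) [Field K] (σ : Type)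
variable (M : Type) [AddCommGroup M] [Module K M] [Module (MvPolynomial σ K) M]
  [IsScalarTower K (MvPolynomial σ K) M]

/-- The Stanley space `w K[A]`: the `K`-span of `{u • w : u a monomial in the variables of A}`. -/
noncomputable def stanleySpace (w : M) (A : Finset σ) : Submodule K M :=
  Submodule.span K { m | ∃ u : σ →₀ ℕ, (↑u.support : Set σ) ⊆ ↑A ∧
    m = (monomial u (1 : K) : MvPolynomial σ K) • w }

/-- `(w, A)` indexed by `Fin r` gives a Stanley decomposition of `M`:
each Stanley space `wᵢ K[Aᵢ]` is a free `K[Aᵢ]`-module and `M` is their internal direct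
sum as a `K`-vector space. -/
def IsStanleyDecomp {r : ℕ} (w : Fin r → M) (A : Fin r → Finset σ) : Prop :=
  (∀ i (f : MvPolynomial σ K), (↑f.vars : Set σ) ⊆ ↑(A i) → f • w i = 0 → f = 0) ∧
  (iSupIndep fun i => stanleySpace K σ M (w i) (A i)) ∧
  (⨆ i, stanleySpace K σ M (w i) (A i)) = ⊤

/-- The Stanley depth of `M`: the largest value of `minᵢ |Aᵢ|` over all Stanley
decompositions of `M`. -/
noncomputable def sdepth : ℕ :=
  sSup { d | ∃ r, ∃ w : Fin r → M, ∃ A : Fin r → Finset σ,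
    IsStanleyDecomp K σ M w A ∧ d = sInf (Set.range fun i => (A i).card) }

/-- The depth of `M` with respect to the maximal graded ideal `(x₁, …, x_N)`:
the maximal length of an `M`-regular sequence of elements of that ideal. -/
noncomputable def rdepth : ℕ :=
  sSup { d | ∃ rs : List (MvPolynomial σ K), rs.length = d ∧
    (∀ f ∈ rs, f ∈ Ideal.span (Set.range (X : σ → MvPolynomial σ K))) ∧
    RingTheory.Sequence.IsRegular M rs }

end Defs

/-- Adjacency in the strong product `Pₙ ⊠ Pₘ` (vertices `(i,j)`, `0`-indexed): distinct
vertices are adjacent iff both coordinates differ by at most `1`. -/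
def pAdj (n m : ℕ) (a b : Fin n × Fin m) : Prop :=
  a ≠ b ∧ |((a.1 : ℤ) - (b.1 : ℤ))| ≤ 1 ∧ |((a.2 : ℤ) - (b.2 : ℤ))| ≤ 1

/-- Adjacency in the strong product `Cₙ ⊠ Pₘ` (vertices `(i,j)`, `0`-indexed). -/
def cAdj (n m : ℕ) (a b : Fin n × Fin m) : Prop :=
  a ≠ b ∧ min ((a.1 : ℤ) - (b.1 : ℤ)).natAbs (n - ((a.1 : ℤ) - (b.1 : ℤ)).natAbs) ≤ 1 ∧
    |((a.2 : ℤ) - (b.2 : ℤ))| ≤ 1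

/-- The edge ideal of the graph with vertex set `V` and adjacency relation `Adj`. -/
noncomputable def edgeIdeal (K : Type) [Field K] {V : Type} (Adj : V → V → Prop) :
    Ideal (MvPolynomial V K) :=
  Ideal.span { p | ∃ a b : V, Adj a b ∧ p = X a * X b }

section Main

open MvPolynomial CategoryTheory Abelian RingTheory.Sequence
open scoped Pointwise

/-- sr -/
noncomputable def srIdeal (K : Type) [Field K] {σ : Type} (Δ : LowerSet (Finset σ)) :
    Ideal (MvPolynomial σ K) where
  carrier := {p | ∀ u : σ →₀ ℕ, u.support ∈ Δ → coeff u p = 0}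
  add_mem' := by
    intro a b ha hb u hu
    rw [coeff_add, ha u hu, hb u hu, add_zero]
  zero_mem' := by intro u _; simp
  smul_mem' := by
    classical
    intro c p hp u hu
    rw [smul_eq_mul, coeff_mul]
    refine Finset.sum_eq_zero fun x hx => ?_
    rw [hp x.2, mul_zero]
    refine Δ.lower ?_ hu
    rw [Finset.HasAntidiagonal.mem_antidiagonal] at hx
    rw [← hx]
    intro i hi
    simp only [Finsupp.mem_support_iff, Finsupp.add_apply] at hi ⊢
    omega

lemma mem_srIdeal {K : Type} [Field K] {σ : Type} {Δ : LowerSet (Finset σ)}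
    {p : MvPolynomial σ K} :
    p ∈ srIdeal K Δ ↔ ∀ u : σ →₀ ℕ, u.support ∈ Δ → coeff u p = 0 := Iff.rfl

/-- The ideal of variables. -/
noncomputable abbrev mIdeal (K : Type) [Field K] (σ : Type) : Ideal (MvPolynomial σ K) :=
  Ideal.span (Set.range (X : σ → MvPolynomial σ K))

lemma mem_mIdeal {K : Type} [Field K] {σ : Type} {p : MvPolynomial σ K} :
    p ∈ mIdeal K σ ↔ coeff 0 p = 0 := by
  rw [mIdeal, ← Set.image_univ, mem_ideal_span_X_image]
  constructor
  · intro h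
    by_contra h0
    obtain ⟨i, -, hi⟩ := h 0 (mem_support_iff.2 h0)
    exact hi rfl
  · intro h m hm
    by_contra! hc
    have : m = 0 := by ext i; simpa using hc i (Set.mem_univ i)
    rw [this, mem_support_iff] at hm
    exact hm h

/-- has a regular sequence of length `t`. -/
def HasReg (K : Type) [Field K] {σ : Type} (J : Ideal (MvPolynomial σ K)) (t : ℕ) : Prop :=
  ∃ rs : List (MvPolynomial σ K), rs.length = t ∧ (∀ f ∈ rs, f ∈ mIdeal K σ) ∧
    IsRegular (MvPolynomial σ K ⧸ J) rs

section
variable {K : Type} [Field K] {σ : Type}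

lemma mIdeal_ne_top : mIdeal K σ ≠ ⊤ := by
  intro h
  have : (1 : MvPolynomial σ K) ∈ mIdeal K σ := by rw [h]; trivial
  rw [mem_mIdeal] at this
  simp at this

lemma smul_lt {J : Ideal (MvPolynomial σ K)} (hJ : J ≤ mIdeal K σ) :
    mIdeal K σ • (⊤ : Submodule (MvPolynomial σ K) (MvPolynomial σ K ⧸ J)) < ⊤ := by
  rw [lt_top_iff_ne_top]
  intro h
  have h1 : (Ideal.Quotient.mk J 1) ∈
      mIdeal K σ • (⊤ : Submodule (MvPolynomial σ K) (MvPolynomial σ K ⧸ J)) := by rw [h]; trivial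
  have h2 : mIdeal K σ • (⊤ : Submodule (MvPolynomial σ K) (MvPolynomial σ K ⧸ J)) ≤
      Submodule.map (Submodule.mkQ J) (mIdeal K σ) := by
    rw [Submodule.smul_le]
    intro r hr n _
    obtain ⟨q, rfl⟩ := Submodule.mkQ_surjective J n
    exact ⟨r * q, Ideal.mul_mem_right _ _ hr, rfl⟩
  obtain ⟨q, hq, hq'⟩ := h2 h1
  have : q - 1 ∈ J := by
    rw [← Ideal.Quotient.eq]; exact hq'
  have h3 := (mIdeal K σ).sub_mem hq (hJ this)
  rw [sub_sub_cancel] at h3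
  exact mIdeal_ne_top ((Ideal.eq_top_iff_one _).2 h3)

lemma HasReg.cone {J J2 : Ideal (MvPolynomial σ K)}
    (x : MvPolynomial σ K) (hx : x ∈ mIdeal K σ)
    (h1 : ∀ p, x * p ∈ J → p ∈ J) (h2 : ∀ p, p ∈ J2 ↔ ∃ q, p - x * q ∈ J) {t : ℕ}
    (H2 : HasReg K J2 t) : HasReg K J (t + 1) := by
  obtain ⟨rs, hl, hm, hr⟩ := H2
  refine ⟨x :: rs, by simp [hl], by simpa [hx] using hm, ?_⟩
  rw [isRegular_cons_iff]
  have hle : J ≤ J2 := fun p hp => (h2 p).2 ⟨0, by simpa using hp⟩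
  let g : (MvPolynomial σ K ⧸ J) →ₗ[MvPolynomial σ K] (MvPolynomial σ K ⧸ J2) :=
    Submodule.mapQ J J2 LinearMap.id hle
  have hg : ∀ p, g (Submodule.Quotient.mk p) = Submodule.Quotient.mk p := fun p => rfl
  have hsurj : Function.Surjective g := by
    intro a
    obtain ⟨p, rfl⟩ := Submodule.Quotient.mk_surjective _ a
    exact ⟨Submodule.Quotient.mk p, rfl⟩
  have hker : LinearMap.ker g =
      x • (⊤ : Submodule (MvPolynomial σ K) (MvPolynomial σ K ⧸ J)) := by
    ext a
    obtain ⟨p, rfl⟩ := Submodule.Quotient.mk_surjective _ a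
    rw [LinearMap.mem_ker, hg, Submodule.Quotient.mk_eq_zero, h2,
      Submodule.mem_smul_pointwise_iff_exists]
    constructor
    · rintro ⟨q, hq⟩
      exact ⟨Submodule.Quotient.mk q, trivial, ((Submodule.Quotient.eq _).2 hq).symm⟩
    · rintro ⟨b, -, hb⟩
      obtain ⟨q, rfl⟩ := Submodule.Quotient.mk_surjective _ b
      exact ⟨q, (Submodule.Quotient.eq _).1 hb.symm⟩
  refine ⟨?_, ?_⟩
  · rw [isSMulRegular_iff_right_eq_zero_of_smul]
    intro a ha
    obtain ⟨p, rfl⟩ := Submodule.Quotient.mk_surjective _ a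
    rw [← Submodule.Quotient.mk_smul, Submodule.Quotient.mk_eq_zero] at ha
    rw [Submodule.Quotient.mk_eq_zero]
    exact h1 p ha
  · exact (LinearEquiv.isRegular_congr ((Submodule.quotEquivOfEq _ _ hker.symm).trans
      (g.quotKerEquivOfSurjective hsurj)) rs).2 hr

variable [Finite σ]

lemma hasReg_iff {J : Ideal (MvPolynomial σ K)} (hJ : J ≤ mIdeal K σ) (t : ℕ) :
    HasReg K J t ↔ ∀ i < t, Subsingleton (Ext (ModuleCat.of (MvPolynomial σ K)
      (Shrink.{0} (MvPolynomial σ K ⧸ mIdeal K σ)))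
      (ModuleCat.of (MvPolynomial σ K) (MvPolynomial σ K ⧸ J)) i) :=
  ((ModuleCat.exists_isRegular_tfae (mIdeal K σ) t
    (ModuleCat.of (MvPolynomial σ K) (MvPolynomial σ K ⧸ J)) (smul_lt hJ)).out 1 3).symm

lemma HasReg.mono {J : Ideal (MvPolynomial σ K)} (hJ : J ≤ mIdeal K σ) {t s : ℕ}
    (h : HasReg K J t) (hst : s ≤ t) : HasReg K J s := by
  rw [hasReg_iff hJ] at h ⊢
  exact fun i hi => h i (hi.trans_le hst)

lemma HasReg.ses {J J1 J2 : Ideal (MvPolynomial σ K)} (hJ : J ≤ mIdeal K σ)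
    (hJ1 : J1 ≤ mIdeal K σ) (hJ2 : J2 ≤ mIdeal K σ) (x : MvPolynomial σ K)
    (h1 : ∀ p, p ∈ J1 ↔ x * p ∈ J) (h2 : ∀ p, p ∈ J2 ↔ ∃ q, p - x * q ∈ J) {t : ℕ}
    (H1 : HasReg K J1 t) (H2 : HasReg K J2 t) : HasReg K J t := by
  rw [hasReg_iff hJ1] at H1
  rw [hasReg_iff hJ2] at H2
  rw [hasReg_iff hJ]
  let f : (MvPolynomial σ K ⧸ J1) →ₗ[MvPolynomial σ K] (MvPolynomial σ K ⧸ J) :=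
    Submodule.mapQ J1 J (LinearMap.lsmul _ _ x) (fun p hp => by
      simpa using (h1 p).1 hp)
  have hle : J ≤ J2 := fun p hp => (h2 p).2 ⟨0, by simpa using hp⟩
  let g : (MvPolynomial σ K ⧸ J) →ₗ[MvPolynomial σ K] (MvPolynomial σ K ⧸ J2) :=
    Submodule.mapQ J J2 LinearMap.id hle
  have hf : ∀ p, f (Submodule.Quotient.mk p) = Submodule.Quotient.mk (x * p) := fun p => rfl
  have hg : ∀ p, g (Submodule.Quotient.mk p) = Submodule.Quotient.mk p := fun p => rfl
  have hinj : Function.Injective f := by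
    rw [injective_iff_map_eq_zero]
    intro a
    obtain ⟨p, rfl⟩ := Submodule.Quotient.mk_surjective _ a
    rw [hf, Submodule.Quotient.mk_eq_zero, Submodule.Quotient.mk_eq_zero]
    exact (h1 p).2
  have hsurj : Function.Surjective g := by
    intro a
    obtain ⟨p, rfl⟩ := Submodule.Quotient.mk_surjective _ a
    exact ⟨Submodule.Quotient.mk p, rfl⟩
  have hex : Function.Exact f g := by
    intro a
    obtain ⟨p, rfl⟩ := Submodule.Quotient.mk_surjective _ a
    rw [hg, Submodule.Quotient.mk_eq_zero, h2]
    constructor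
    · rintro ⟨q, hq⟩
      refine ⟨Submodule.Quotient.mk q, ?_⟩
      rw [hf]
      exact ((Submodule.Quotient.eq _).2 hq).symm
    · rintro ⟨b, hb⟩
      obtain ⟨q, rfl⟩ := Submodule.Quotient.mk_surjective _ b
      rw [hf] at hb
      exact ⟨q, (Submodule.Quotient.eq _).1 hb.symm⟩
  let SC : ShortComplex (ModuleCat (MvPolynomial σ K)) :=
    ShortComplex.mk (ModuleCat.ofHom f) (ModuleCat.ofHom g) (by
      exact ModuleCat.hom_ext (LinearMap.ext fun a => hex.apply_apply_eq_zero a))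
  have hSC : SC.ShortExact :=
    { exact := (ShortComplex.ShortExact.moduleCat_exact_iff_function_exact SC).2 hex
      mono_f := (ModuleCat.mono_iff_injective _).2 hinj
      epi_g := (ModuleCat.epi_iff_surjective _).2 hsurj }
  intro i hi
  have zero1 := AddCommGrpCat.isZero_of_iff_subsingleton.mpr (H1 i hi)
  have zero2 := AddCommGrpCat.isZero_of_iff_subsingleton.mpr (H2 i hi)
  exact AddCommGrpCat.subsingleton_of_isZero <| ShortComplex.Exact.isZero_of_both_zeros
        (Ext.covariant_sequence_exact₂' (ModuleCat.of (MvPolynomial σ K)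
      (Shrink.{0} (MvPolynomial σ K ⧸ mIdeal K σ))) hSC i)
        (zero1.eq_zero_of_src _) (zero2.eq_zero_of_tgt _)

end

section combin
variable {σ : Type} [DecidableEq σ]

/-- Independence complex of the induced subgraph on `W`. -/
def indCx (Adj : σ → σ → Prop) (W : Finset σ) : LowerSet (Finset σ) where
  carrier := {F | F ⊆ W ∧ ∀ a ∈ F, ∀ b ∈ F, ¬ Adj a b}
  lower' := by
    intro F G hGF hF
    exact ⟨Finset.Subset.trans hGF hF.1, fun a ha b hb => hF.2 a (hGF ha) b (hGF hb)⟩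

lemma mem_indCx {Adj : σ → σ → Prop} {W F : Finset σ} :
    F ∈ indCx Adj W ↔ F ⊆ W ∧ ∀ a ∈ F, ∀ b ∈ F, ¬ Adj a b := Iff.rfl

/-- Deletion/link recursion certifying lower bounds. -/
inductive DT (Adj : σ → σ → Prop) : Finset σ → ℕ → Prop
  | empty : DT Adj ∅ 0
  | mono {W : Finset σ} {t s : ℕ} : DT Adj W t → s ≤ t → DT Adj W s
  | step {W W' : Finset σ} {v : σ} {t s : ℕ} : v ∈ W → DT Adj (W.erase v) t →
      (∀ u, u ∈ W' ↔ u ∈ W ∧ u ≠ v ∧ ¬ Adj u v) → DT Adj W' s → t ≤ s + 1 → DT Adj W t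
  | iso {W : Finset σ} {v : σ} {t : ℕ} : v ∉ W → (∀ u ∈ W, ¬ Adj u v) → DT Adj W t →
      DT Adj (insert v W) (t + 1)

lemma mem_indCx_erase {Adj : σ → σ → Prop} {W F : Finset σ} {v : σ} :
    F ∈ indCx Adj (W.erase v) ↔ F ∈ indCx Adj W ∧ v ∉ F := by
  simp only [mem_indCx, Finset.subset_erase]
  tauto

lemma insert_mem_indCx_iso {Adj : σ → σ → Prop} (hs : ∀ a b, Adj a b → Adj b a)
    (hi : ∀ a, ¬ Adj a a) {W F : Finset σ} {v : σ} (h : ∀ u ∈ W, ¬ Adj u v)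
    (hF : F ∈ indCx Adj (insert v W)) : insert v F ∈ indCx Adj (insert v W) := by
  rw [mem_indCx] at hF ⊢
  refine ⟨Finset.insert_subset (Finset.mem_insert_self _ _) hF.1, ?_⟩
  have key : ∀ a ∈ F, ¬ Adj a v := by
    intro a ha
    rcases Finset.mem_insert.1 (hF.1 ha) with rfl | h'
    · exact hi _
    · exact h a h'
  intro a ha b hb
  rcases Finset.mem_insert.1 ha with ha | ha <;> rcases Finset.mem_insert.1 hb with hb | hb
  · rw [ha, hb]; exact hi _
  · rw [ha]; exact fun h' => key b hb (hs _ _ h')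
  · rw [hb]; exact key a ha
  · exact hF.2 a ha b hb

lemma insert_mem_indCx_step {Adj : σ → σ → Prop} (hs : ∀ a b, Adj a b → Adj b a)
    (hi : ∀ a, ¬ Adj a a) {W W' F : Finset σ} {v : σ} (hv : v ∈ W)
    (h : ∀ u, u ∈ W' ↔ u ∈ W ∧ u ≠ v ∧ ¬ Adj u v) :
    F ∈ indCx Adj (insert v W') ↔ insert v F ∈ indCx Adj W := by
  constructor
  · intro hF
    have h1 := insert_mem_indCx_iso hs hi (fun u hu => ((h u).1 hu).2.2) hF
    rw [mem_indCx] at h1 ⊢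
    refine ⟨h1.1.trans (Finset.insert_subset hv fun u hu => ((h u).1 hu).1), h1.2⟩
  · intro hF
    rw [mem_indCx] at hF ⊢
    refine ⟨fun u hu => ?_, fun a ha b hb => hF.2 a (Finset.mem_insert_of_mem ha) b
      (Finset.mem_insert_of_mem hb)⟩
    by_cases huv : u = v
    · exact huv ▸ Finset.mem_insert_self _ _
    · refine Finset.mem_insert_of_mem ((h u).2 ⟨hF.1 (Finset.mem_insert_of_mem hu), huv, ?_⟩)
      exact hF.2 u (Finset.mem_insert_of_mem hu) v (Finset.mem_insert_self _ _)

lemma empty_mem_indCx {Adj : σ → σ → Prop} {W : Finset σ} : ∅ ∈ indCx Adj W := by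
  simp [mem_indCx]

lemma support_single_add (v : σ) (u : σ →₀ ℕ) :
    (Finsupp.single v 1 + u).support = insert v u.support := by
  ext i
  by_cases h : i = v
  · subst h; simp
  · simp [h]

lemma support_sub_single_insert {v : σ} {u : σ →₀ ℕ} (h : v ∈ u.support) :
    Finsupp.single v 1 + (u - Finsupp.single v 1) = u := by
  have : Finsupp.single v 1 ≤ u := by
    rw [Finsupp.single_le_iff]
    have := Finsupp.mem_support_iff.1 h
    omega
  exact add_tsub_cancel_of_le this

section alg
variable {K : Type} [Field K]

lemma sr_le {Adj : σ → σ → Prop} (W : Finset σ) : srIdeal K (indCx Adj W) ≤ mIdeal K σ := by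
  intro p hp
  rw [mem_mIdeal]
  exact hp 0 (by simpa using empty_mem_indCx)

lemma sr_del {Adj : σ → σ → Prop} (W : Finset σ) (v : σ) (p : MvPolynomial σ K) :
    p ∈ srIdeal K (indCx Adj (W.erase v)) ↔
      ∃ q, p - X v * q ∈ srIdeal K (indCx Adj W) := by
  constructor
  · intro hp
    refine ⟨p.divMonomial (Finsupp.single v 1), fun u hu => ?_⟩
    rw [coeff_sub, coeff_X_mul']
    split_ifs with h
    · rw [coeff_divMonomial, support_sub_single_insert h, sub_self]
    · rw [sub_zero]
      exact hp u (mem_indCx_erase.2 ⟨hu, h⟩)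
  · rintro ⟨q, hq⟩ u hu
    rw [mem_indCx_erase] at hu
    have := hq u hu.1
    rwa [coeff_sub, coeff_X_mul', if_neg hu.2, sub_zero] at this

lemma sr_colon {Adj : σ → σ → Prop} (hs : ∀ a b, Adj a b → Adj b a)
    (hi : ∀ a, ¬ Adj a a) {W W' : Finset σ} {v : σ} (hv : v ∈ W)
    (h : ∀ u, u ∈ W' ↔ u ∈ W ∧ u ≠ v ∧ ¬ Adj u v) (p : MvPolynomial σ K) :
    p ∈ srIdeal K (indCx Adj (insert v W')) ↔ X v * p ∈ srIdeal K (indCx Adj W) := by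
  constructor
  · intro hp u hu
    rw [coeff_X_mul']
    split_ifs with h'
    · apply hp
      rw [insert_mem_indCx_step hs hi hv h, ← support_single_add, support_sub_single_insert h']
      exact hu
    · rfl
  · intro hp u hu
    have := hp (Finsupp.single v 1 + u) (by
      rw [support_single_add]; exact (insert_mem_indCx_step hs hi hv h).1 hu)
    rwa [coeff_X_mul] at this

variable [Finite σ]

lemma X_mem_mIdeal (v : σ) : (X v : MvPolynomial σ K) ∈ mIdeal K σ :=
  Ideal.subset_span ⟨v, rfl⟩

lemma hasReg_iso {Adj : σ → σ → Prop} (hs : ∀ a b, Adj a b → Adj b a)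
    (hi : ∀ a, ¬ Adj a a) {W : Finset σ} {v : σ} {t : ℕ} (hv : v ∉ W)
    (h : ∀ u ∈ W, ¬ Adj u v) (H : HasReg K (srIdeal K (indCx Adj W)) t) :
    HasReg K (srIdeal K (indCx Adj (insert v W))) (t + 1) := by
  refine HasReg.cone (J2 := srIdeal K (indCx Adj W)) (X v) (X_mem_mIdeal v) ?_ ?_ H
  · intro p hp
    rw [sr_colon hs hi (W := insert v W) (W' := W) (Finset.mem_insert_self _ _)]
    · exact hp
    · intro u
      by_cases huv : u = v
      · subst huv; simp [hv]
      · simp only [Finset.mem_insert, huv, false_or, ne_eq, not_false_eq_true, true_and]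
        exact ⟨fun h' => ⟨h', h u h'⟩, fun h' => h'.1⟩
  · intro p
    have := sr_del (K := K) (Adj := Adj) (insert v W) v p
    rwa [Finset.erase_insert hv] at this

lemma DT.hasReg {Adj : σ → σ → Prop} (hs : ∀ a b, Adj a b → Adj b a)
    (hi : ∀ a, ¬ Adj a a) {W : Finset σ} {t : ℕ} (h : DT Adj W t) :
    HasReg K (srIdeal K (indCx Adj W)) t := by
  induction h with
  | empty =>
    refine ⟨[], rfl, by simp, ?_⟩
    have : Nontrivial (MvPolynomial σ K ⧸ srIdeal K (indCx Adj ∅)) :=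
      Ideal.Quotient.nontrivial_iff.2 (ne_top_of_le_ne_top mIdeal_ne_top (sr_le _))
    exact IsRegular.nil _ _
  | mono _ hst ih => exact ih.mono (sr_le _) hst
  | @step W W' v t s hv _ hW' _ hts ih1 ih2 =>
    have h3 := hasReg_iso hs hi (v := v) (fun h => ((hW' v).1 h).2.1 rfl)
      (fun u hu => ((hW' u).1 hu).2.2) ih2
    exact HasReg.ses (sr_le _) (sr_le _) (sr_le _) (X v) (sr_colon hs hi hv hW')
      (sr_del W v) (h3.mono (sr_le _) hts) ih1
  | iso hv h _ ih => exact hasReg_iso hs hi hv h ih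

end alg

/-- Combinatorial Stanley decomposition. -/
def CD (Adj : σ → σ → Prop) (W : Finset σ) (t : ℕ) : Prop :=
  ∃ (ι : Type) (_ : Fintype ι) (w : ι → σ →₀ ℕ) (A : ι → Finset σ),
    (∀ i, t ≤ (A i).card) ∧ (∀ i, A i ⊆ W) ∧
    (∀ i a, a.support ⊆ A i → (w i + a).support ∈ indCx Adj W) ∧
    (∀ u : σ →₀ ℕ, u.support ∈ indCx Adj W → ∃ i a, a.support ⊆ A i ∧ u = w i + a) ∧
    (∀ i j a b, a.support ⊆ A i → b.support ⊆ A j → w i + a = w j + b → i = j)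

lemma CD.mono {Adj : σ → σ → Prop} {W : Finset σ} {t s : ℕ} (h : CD Adj W t) (hst : s ≤ t) :
    CD Adj W s := by
  obtain ⟨ι, hι, w, A, h1, h2⟩ := h
  exact ⟨ι, hι, w, A, fun i => hst.trans (h1 i), h2⟩

lemma CD.iso {Adj : σ → σ → Prop} (hs : ∀ a b, Adj a b → Adj b a)
    (hi : ∀ a, ¬ Adj a a) {W : Finset σ} {v : σ} {t : ℕ} (hv : v ∉ W)
    (h : ∀ u ∈ W, ¬ Adj u v) (H : CD Adj W t) : CD Adj (insert v W) (t + 1) := by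
  obtain ⟨ι, hι, w, A, h1, h2, h3, h4, h5⟩ := H
  have hw : ∀ i, (w i).erase v = w i := by
    intro i
    rw [Finsupp.erase_of_notMem_support]
    have := h3 i 0 (by simp)
    rw [add_zero] at this
    exact fun h => hv (this.1 h)
  have he : ∀ (a : σ →₀ ℕ) (i : ι), a.support ⊆ insert v (A i) → (a.erase v).support ⊆ A i := by
    intro a i ha
    rw [Finsupp.support_erase]
    intro x hx
    rw [Finset.mem_erase] at hx
    exact (Finset.mem_insert.1 (ha hx.2)).resolve_left hx.1
  refine ⟨ι, hι, w, fun i => insert v (A i), fun i => ?_, fun i => ?_, ?_, ?_, ?_⟩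
  · rw [Finset.card_insert_of_notMem (fun h => hv (h2 i h))]
    exact Nat.succ_le_succ (h1 i)
  · exact Finset.insert_subset_insert _ (h2 i)
  · intro i a ha
    have h6 := h3 i (a.erase v) (he a i ha)
    have h7 : (w i + a.erase v).support ∈ indCx Adj (insert v W) :=
      ⟨h6.1.trans (Finset.subset_insert _ _), h6.2⟩
    refine (indCx Adj (insert v W)).lower ?_ (insert_mem_indCx_iso hs hi h h7)
    intro x hx
    by_cases hxv : x = v
    · exact hxv ▸ Finset.mem_insert_self _ _
    · refine Finset.mem_insert_of_mem ?_
      simpa [Finsupp.erase_ne hxv] using hx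
  · intro u hu
    obtain ⟨i, a, ha, hua⟩ := h4 (u.erase v) (by
      rw [Finsupp.support_erase]
      refine ⟨?_, fun a ha b hb => hu.2 a (Finset.mem_of_mem_erase ha) b
        (Finset.mem_of_mem_erase hb)⟩
      intro x hx
      rw [Finset.mem_erase] at hx
      exact (Finset.mem_insert.1 (hu.1 hx.2)).resolve_left hx.1)
    refine ⟨i, a + Finsupp.single v (u v), ?_, ?_⟩
    · refine Finsupp.support_add.trans (Finset.union_subset
        (ha.trans (Finset.subset_insert _ _)) ?_)
      exact Finsupp.support_single_subset.trans (by simp)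
    · rw [← add_assoc, ← hua, Finsupp.erase_add_single]
  · intro i j a b ha hb hab
    refine h5 i j (a.erase v) (b.erase v) (he a i ha) (he b j hb) ?_
    have := congrArg (Finsupp.erase v) hab
    rwa [Finsupp.erase_add, Finsupp.erase_add, hw, hw] at this

lemma CD.step {Adj : σ → σ → Prop} (hs : ∀ a b, Adj a b → Adj b a)
    (hi : ∀ a, ¬ Adj a a) {W W' : Finset σ} {v : σ} {t : ℕ} (hv : v ∈ W)
    (h : ∀ u, u ∈ W' ↔ u ∈ W ∧ u ≠ v ∧ ¬ Adj u v)
    (H1 : CD Adj (W.erase v) t) (H2 : CD Adj (insert v W') t) : CD Adj W t := by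
  obtain ⟨ι, _, w, A, h1, h2, h3, h4, h5⟩ := H1
  obtain ⟨ι', _, w', A', h1', h2', h3', h4', h5'⟩ := H2
  have hne : ∀ i a, a.support ⊆ A i → v ∉ (w i + a).support := fun i a ha =>
    (mem_indCx_erase.1 (h3 i a ha)).2
  have hmem : ∀ (i : ι') (a : σ →₀ ℕ), v ∈ (Finsupp.single v 1 + w' i + a).support := by
    intro i a; rw [add_assoc, support_single_add]; exact Finset.mem_insert_self _ _
  refine ⟨ι ⊕ ι', inferInstance, Sum.elim w (fun i => Finsupp.single v 1 + w' i),
    Sum.elim A A', ?_, ?_, ?_, ?_, ?_⟩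
  · rintro (i | i)
    · exact h1 i
    · exact h1' i
  · rintro (i | i)
    · exact (h2 i).trans (Finset.erase_subset _ _)
    · exact (h2' i).trans (Finset.insert_subset hv fun u hu => ((h u).1 hu).1)
  · rintro (i | i) a ha
    · exact (mem_indCx_erase.1 (h3 i a ha)).1
    · rw [Sum.elim_inr, add_assoc, support_single_add]
      exact (insert_mem_indCx_step hs hi hv h).1 (h3' i a ha)
  · intro u hu
    by_cases hvu : v ∈ u.support
    · obtain ⟨i, a, ha, hua⟩ := h4' (u - Finsupp.single v 1) (by
        rw [insert_mem_indCx_step hs hi hv h, ← support_single_add,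
          support_sub_single_insert hvu]
        exact hu)
      refine ⟨Sum.inr i, a, ha, ?_⟩
      rw [Sum.elim_inr, add_assoc, ← hua, support_sub_single_insert hvu]
    · obtain ⟨i, a, ha, hua⟩ := h4 u (mem_indCx_erase.2 ⟨hu, hvu⟩)
      exact ⟨Sum.inl i, a, ha, hua⟩
  · rintro (i | i) (j | j) a b ha hb hab
    · rw [h5 i j a b ha hb hab]
    · exact absurd (hab ▸ hmem j b) (hne i a ha)
    · exact absurd (hab.symm ▸ hmem i a) (hne j b hb)
    · rw [Sum.elim_inr, Sum.elim_inr, add_assoc, add_assoc] at hab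
      rw [h5' i j a b ha hb (add_left_cancel hab)]

lemma DT.cd {Adj : σ → σ → Prop} (hs : ∀ a b, Adj a b → Adj b a)
    (hi : ∀ a, ¬ Adj a a) {W : Finset σ} {t : ℕ} (h : DT Adj W t) : CD Adj W t := by
  induction h with
  | empty =>
    refine ⟨Unit, inferInstance, fun _ => 0, fun _ => ∅, by simp, by simp, ?_, ?_, ?_⟩
    · intro i a ha
      have : a = 0 := by simpa using ha
      subst this
      simpa using empty_mem_indCx
    · intro u hu
      exact ⟨(), 0, by simp, by simpa using hu.1⟩
    · simp
  | mono _ hst ih => exact ih.mono hst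
  | @step W W' v t s hv _ hW' _ hts ih1 ih2 =>
    have h3 := CD.iso hs hi (v := v) (fun h => ((hW' v).1 h).2.1 rfl)
      (fun u hu => ((hW' u).1 hu).2.2) ih2
    exact CD.step hs hi hv hW' ih1 (h3.mono hts)
  | iso hv h _ ih => exact CD.iso hs hi hv h ih

end combin

section stanley
variable {K : Type} [Field K] {σ : Type}

/-- Coefficient functional on the quotient. -/
noncomputable def coeffFn (Δ : LowerSet (Finset σ)) (u : σ →₀ ℕ) (hu : u.support ∈ Δ) :
    (MvPolynomial σ K ⧸ srIdeal K Δ) →ₗ[K] K :=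
  (((srIdeal K Δ).restrictScalars K).liftQ (lcoeff K u) (fun p hp => hp u hu)) ∘ₗ
    (Submodule.Quotient.restrictScalarsEquiv K (srIdeal K Δ)).symm.toLinearMap

lemma coeffFn_mk (Δ : LowerSet (Finset σ)) (u : σ →₀ ℕ) (hu : u.support ∈ Δ)
    (p : MvPolynomial σ K) : coeffFn Δ u hu (Ideal.Quotient.mk _ p) = coeff u p := rfl

/-- The monomial basis of the quotient. -/
noncomputable def monB (K : Type) [Field K] {σ : Type} (Δ : LowerSet (Finset σ))
    (u : {u : σ →₀ ℕ // u.support ∈ Δ}) : MvPolynomial σ K ⧸ srIdeal K Δ :=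
  Ideal.Quotient.mk _ (monomial u.1 1)

lemma monB_li (Δ : LowerSet (Finset σ)) : LinearIndependent K (monB K Δ) := by
  classical
  rw [linearIndependent_iff']
  intro s g hg i hi
  have := congrArg (coeffFn Δ i.1 i.2) hg
  rw [map_sum, map_zero, Finset.sum_eq_single i] at this
  · simpa [monB, coeffFn_mk] using this
  · intro b _ hb
    have : b.1 ≠ i.1 := fun h => hb (Subtype.ext h)
    simp [monB, coeffFn_mk, coeff_monomial, this]
  · exact fun h => absurd hi h

lemma stanleySpace_eq (Δ : LowerSet (Finset σ)) (w : σ →₀ ℕ) (A : Finset σ)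
    (h : ∀ a : σ →₀ ℕ, a.support ⊆ A → (w + a).support ∈ Δ) :
    stanleySpace K σ (MvPolynomial σ K ⧸ srIdeal K Δ) (Ideal.Quotient.mk _ (monomial w 1)) A =
      Submodule.span K (monB K Δ '' {u | ∃ a : σ →₀ ℕ, a.support ⊆ A ∧ u.1 = w + a}) := by
  unfold stanleySpace
  congr 1
  ext m
  constructor
  · rintro ⟨a, ha, rfl⟩
    refine ⟨⟨w + a, h a (by exact_mod_cast ha)⟩, ⟨a, by exact_mod_cast ha, rfl⟩, ?_⟩
    change Ideal.Quotient.mk _ _ = Ideal.Quotient.mk _ (monomial a 1 * monomial w 1)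
    rw [monomial_mul, add_comm a w, mul_one]
  · rintro ⟨u, ⟨a, ha, hu⟩, rfl⟩
    refine ⟨a, by exact_mod_cast ha, ?_⟩
    change Ideal.Quotient.mk _ _ = Ideal.Quotient.mk _ (monomial a 1 * monomial w 1)
    rw [monomial_mul, add_comm, mul_one, hu]

lemma CD.stanley [DecidableEq σ] {Adj : σ → σ → Prop} {W : Finset σ} {t : ℕ}
    (H : CD Adj W t) :
    ∃ r, ∃ w : Fin r → (MvPolynomial σ K ⧸ srIdeal K (indCx Adj W)), ∃ A : Fin r → Finset σ,
    IsStanleyDecomp K σ (MvPolynomial σ K ⧸ srIdeal K (indCx Adj W)) w A ∧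
      t ≤ sInf (Set.range fun i => (A i).card) := by
  obtain ⟨ι, hι, w, A, h1, h2, h3, h4, h5⟩ := H
  let e := Fintype.equivFin ι
  refine ⟨Fintype.card ι, fun i => Ideal.Quotient.mk _ (monomial (w (e.symm i)) 1),
    fun i => A (e.symm i), ⟨?_, ?_, ?_⟩, ?_⟩
  · intro i f hf h0
    change Ideal.Quotient.mk _ (f * monomial (w (e.symm i)) 1) = 0 at h0
    rw [Ideal.Quotient.eq_zero_iff_mem] at h0
    ext u
    rw [coeff_zero]
    by_contra hu
    have hsub : u.support ⊆ A (e.symm i) := by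
      intro x hx
      have : x ∈ f.vars := (mem_vars x).2 ⟨u, mem_support_iff.2 hu, hx⟩
      exact_mod_cast hf this
    have := h0 (w (e.symm i) + u) (h3 _ u hsub)
    rw [add_comm, coeff_mul_monomial, mul_one] at this
    exact hu this
  · intro i
    simp_rw [stanleySpace_eq _ _ _ (h3 _), ← Submodule.span_iUnion, ← Set.image_iUnion]
    refine (monB_li _).disjoint_span_image ?_
    rw [Set.disjoint_left]
    rintro u ⟨a, ha, hu⟩ hu'
    simp only [Set.mem_iUnion] at hu'
    obtain ⟨j, hj, b, hb, hu'⟩ := hu'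
    exact hj (e.symm.injective (h5 _ _ b a hb ha (by rw [← hu, ← hu'])))
  · rw [eq_top_iff]
    rintro x -
    obtain ⟨p, rfl⟩ := Ideal.Quotient.mk_surjective x
    rw [p.as_sum, map_sum]
    refine Submodule.sum_mem _ fun u _ => ?_
    by_cases hu : u.support ∈ indCx Adj W
    · obtain ⟨i, a, ha, hua⟩ := h4 u hu
      refine Submodule.mem_iSup_of_mem (e i) ?_
      rw [stanleySpace_eq _ _ _ (h3 _)]
      have : Ideal.Quotient.mk (srIdeal K (indCx Adj W)) (monomial u (coeff u p)) =
          coeff u p • monB K _ ⟨u, hu⟩ := by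
        change _ = Ideal.Quotient.mk _ (coeff u p • monomial u 1)
        rw [smul_monomial, smul_eq_mul, mul_one]
      rw [this]
      refine Submodule.smul_mem _ _ (Submodule.subset_span ⟨⟨u, hu⟩, ⟨a, ?_, ?_⟩, rfl⟩)
      · rwa [e.symm_apply_apply]
      · rw [e.symm_apply_apply]; exact hua
    · have : Ideal.Quotient.mk (srIdeal K (indCx Adj W)) (monomial u (coeff u p)) = 0 := by
        rw [Ideal.Quotient.eq_zero_iff_mem]
        intro v hv
        rw [coeff_monomial, if_neg]
        rintro rfl
        exact hu hv
      rw [this]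
      exact Submodule.zero_mem _
  · obtain ⟨i, -⟩ := h4 0 (by simpa using empty_mem_indCx)
    refine le_csInf ⟨_, e i, rfl⟩ ?_
    rintro _ ⟨j, rfl⟩
    exact h1 _

/-- Upper bound for Stanley decompositions. -/
lemma stanley_le [DecidableEq σ] {Adj : σ → σ → Prop} {W : Finset σ} {D : Finset σ}
    (hD : D ∈ indCx Adj W) (hmax : ∀ a, a ∉ D → ∃ b ∈ D, a ∉ W ∨ Adj a b)
    {r : ℕ} {w : Fin r → (MvPolynomial σ K ⧸ srIdeal K (indCx Adj W))} {A : Fin r → Finset σ}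
    (H : IsStanleyDecomp K σ (MvPolynomial σ K ⧸ srIdeal K (indCx Adj W)) w A) :
    sInf (Set.range fun i => (A i).card) ≤ D.card := by
  obtain ⟨H1, -, H3⟩ := H
  suffices h : ∃ i, D ⊆ A i by
    obtain ⟨i, hi⟩ := h
    have : A i ⊆ D := by
      intro a ha
      by_contra haD
      obtain ⟨b, hb, hab⟩ := hmax a haD
      have h0 := H1 i (X a * X b) (by
        refine (Finset.coe_subset.2 (vars_mul _ _)).trans ?_
        rw [vars_X, vars_X]
        intro x hx
        rcases Finset.mem_union.1 (Finset.mem_coe.1 hx) with hx | hx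
        · rw [Finset.mem_singleton.1 hx]; exact_mod_cast ha
        · rw [Finset.mem_singleton.1 hx]; exact_mod_cast hi hb) (by
        obtain ⟨p, hp⟩ := Ideal.Quotient.mk_surjective (w i)
        rw [← hp]
        change Ideal.Quotient.mk _ (X a * X b * p) = 0
        rw [Ideal.Quotient.eq_zero_iff_mem]
        refine Ideal.mul_mem_right _ _ ?_
        intro u hu
        rw [mul_comm, coeff_mul_X']
        split_ifs with hau
        · rw [coeff_X', if_neg]
          intro hbu
          have hbm : b ∈ u.support := by
            have : u b ≠ 0 := by
              intro h0
              have := DFunLike.congr_fun hbu b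
              simp [h0] at this
            exact Finsupp.mem_support_iff.2 this
          rcases hab with hab | hab
          · exact hab (hu.1 hau)
          · exact hu.2 a hau b hbm hab
        · rfl)
      exact (mul_ne_zero (X_ne_zero a) (X_ne_zero b)) h0
    have h2 : A i = D := Finset.Subset.antisymm this hi
    calc sInf (Set.range fun i => (A i).card) ≤ (A i).card := Nat.sInf_le ⟨i, rfl⟩
      _ = D.card := by rw [h2]
  by_contra! hno
  choose z hzD hzA using fun i => Finset.not_subset.1 (hno i)
  choose p hp using fun i => Ideal.Quotient.mk_surjective (w i)
  let c : ℕ := ∑ i, (p i).totalDegree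
  let u : σ →₀ ℕ := Finsupp.onFinset D (fun x => if x ∈ D then c + 1 else 0) (by
    intro a ha; by_contra h; simp [h] at ha)
  have hu : u.support ∈ indCx Adj W :=
    (indCx Adj W).lower Finsupp.support_onFinset_subset hD
  have huz : ∀ x ∈ D, u x = c + 1 := by
    intro x hx; simp [u, hx]
  have hker : (⨆ i, stanleySpace K σ (MvPolynomial σ K ⧸ srIdeal K (indCx Adj W)) (w i) (A i)) ≤
      LinearMap.ker (coeffFn (K := K) (indCx Adj W) u hu) := by
    refine iSup_le fun i => ?_
    unfold stanleySpace
    rw [Submodule.span_le]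
    rintro _ ⟨a, ha, rfl⟩
    rw [SetLike.mem_coe, LinearMap.mem_ker, ← hp i]
    change coeffFn _ u hu (Ideal.Quotient.mk _ (monomial a 1 * p i)) = 0
    rw [coeffFn_mk, coeff_monomial_mul']
    split_ifs with hau
    · rw [one_mul]
      by_contra hne
      have h1 := le_totalDegree (mem_support_iff.2 hne)
      have h2 : (p i).totalDegree ≤ c :=
        Finset.single_le_sum (f := fun i => (p i).totalDegree) (fun _ _ => Nat.zero_le _)
          (Finset.mem_univ i)
      have haz : a (z i) = 0 := by
        by_contra h
        exact hzA i (by exact_mod_cast ha (Finset.mem_coe.2 (Finsupp.mem_support_iff.2 h)))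
      have h3 : (u - a) (z i) = c + 1 := by
        rw [Finsupp.tsub_apply, haz, huz _ (hzD i), Nat.sub_zero]
      have h4 : (u - a) (z i) ≤ (u - a).sum fun _ e => e :=
        Finset.single_le_sum (f := fun x => (u - a) x) (fun _ _ => Nat.zero_le _)
          (Finsupp.mem_support_iff.2 (by omega))
      omega
    · rfl
  rw [H3] at hker
  have : coeffFn (K := K) (indCx Adj W) u hu (Ideal.Quotient.mk _ (monomial u 1)) = 0 :=
    hker trivial
  rw [coeffFn_mk, coeff_monomial, if_pos rfl] at this
  exact one_ne_zero this

lemma edgeIdeal_eq [Fintype σ] [DecidableEq σ] {Adj : σ → σ → Prop} (hi : ∀ a, ¬ Adj a a) :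
    edgeIdeal K Adj = srIdeal K (indCx Adj Finset.univ) := by
  apply le_antisymm
  · unfold edgeIdeal
    rw [Ideal.span_le]
    rintro _ ⟨a, b, hab, rfl⟩ u hu
    rw [mul_comm, coeff_mul_X']
    split_ifs with hau
    · rw [coeff_X', if_neg]
      intro hbu
      have hbm : b ∈ u.support := by
        refine Finsupp.mem_support_iff.2 fun h0 => ?_
        have := DFunLike.congr_fun hbu b
        simp [h0] at this
      exact hu.2 a hau b hbm hab
    · rfl
  · intro p hp
    rw [p.as_sum]
    refine Ideal.sum_mem _ fun u hu => ?_
    have : u.support ∉ indCx Adj Finset.univ := fun h => mem_support_iff.1 hu (hp u h)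
    rw [mem_indCx] at this
    push Not at this
    obtain ⟨a, ha, b, hb, hab⟩ := this (Finset.subset_univ _)
    have hne : a ≠ b := fun h => hi a (h ▸ hab)
    have hle : Finsupp.single a 1 + Finsupp.single b 1 ≤ u := by
      intro x
      rw [Finsupp.mem_support_iff] at ha hb
      simp only [Finsupp.add_apply, Finsupp.single_apply]
      split_ifs with h1 h2 h2
      · exact absurd (h1.trans h2.symm) hne
      · subst h1; omega
      · subst h2; omega
      · omega
    have h3 : monomial u (coeff u p) =
        monomial (u - (Finsupp.single a 1 + Finsupp.single b 1)) (coeff u p) *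
          ((X a : MvPolynomial σ K) * X b) := by
      rw [X, X, monomial_mul, monomial_mul, tsub_add_cancel_of_le hle, mul_one, mul_one]
    rw [h3]
    exact Ideal.mul_mem_left _ _ (Ideal.subset_span ⟨a, b, hab, rfl⟩)

end stanley

section comb

lemma cAdj_symm (n : ℕ) (a b : Fin n × Fin 3) (h : cAdj n 3 a b) : cAdj n 3 b a := by
  obtain ⟨h1, h2, h3⟩ := h
  refine ⟨h1.symm, ?_, ?_⟩
  · omega
  · rw [abs_sub_comm]; exact h3

lemma cAdj_irrefl (n : ℕ) (a : Fin n × Fin 3) : ¬ cAdj n 3 a a := fun h => h.1 rfl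

lemma DT.zero {σ : Type} [DecidableEq σ] (Adj : σ → σ → Prop) :
    ∀ (c : ℕ) (W : Finset σ), W.card ≤ c → DT Adj W 0 := by
  classical
  intro c
  induction c with
  | zero =>
    intro W hW
    rw [Finset.card_eq_zero.1 (Nat.le_zero.1 hW)]
    exact DT.empty
  | succ c ih =>
    intro W hW
    rcases W.eq_empty_or_nonempty with rfl | ⟨v, hv⟩
    · exact DT.empty
    · have hc : (W.erase v).card ≤ c := by rw [Finset.card_erase_of_mem hv]; omega
      refine DT.step (W' := (W.erase v).filter fun u => ¬ Adj u v) (s := 0) hv (ih _ hc) ?_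
        (ih _ ((Finset.card_filter_le _ _).trans hc)) (by omega)
      intro u
      simp only [Finset.mem_filter, Finset.mem_erase]
      tauto

lemma DT.step' {σ : Type} [DecidableEq σ] {Adj : σ → σ → Prop} {c t : ℕ} {W : Finset σ}
    {v : σ} (hv : v ∈ W) (hW : W.card ≤ c + 1) (h1 : DT Adj (W.erase v) t)
    (s : ℕ) (hs : t ≤ s + 1)
    (h2 : ∀ W' : Finset σ, W'.card ≤ c → (∀ u, u ∈ W' ↔ u ∈ W ∧ u ≠ v ∧ ¬ Adj u v) →
      DT Adj W' s) : DT Adj W t := by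
  classical
  have hc : (W.erase v).card ≤ c := by rw [Finset.card_erase_of_mem hv]; omega
  have hm : ∀ u, u ∈ ((W.erase v).filter fun u => ¬ Adj u v) ↔ u ∈ W ∧ u ≠ v ∧ ¬ Adj u v := by
    intro u
    simp only [Finset.mem_filter, Finset.mem_erase]
    tauto
  exact DT.step hv h1 hm (h2 _ ((Finset.card_filter_le _ _).trans hc) hm) hs

lemma dt_cols (n : ℕ) : ∀ (c : ℕ) (W : Finset (Fin n × Fin 3)) (a b : ℕ), W.card ≤ c → 1 ≤ a →
    b ≤ n → (∀ v : Fin n × Fin 3, a ≤ v.1.1 → v.1.1 < b → v ∈ W) →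
    DT (cAdj n 3) W ((b - a + 2) / 3) := by
  classical
  intro c
  induction c with
  | zero =>
    intro W a b hW ha hb hsub
    have : ¬ a < b := by
      intro h
      have := hsub (⟨a, by omega⟩, 0) le_rfl h
      rw [Finset.card_eq_zero.1 (Nat.le_zero.1 hW)] at this
      simp at this
    have h0 : (b - a + 2) / 3 = 0 := by omega
    rw [h0]
    exact DT.zero _ _ _ hW
  | succ c ih =>
    intro W a b hW ha hb hsub
    by_cases hab : a < b
    swap
    · have h0 : (b - a + 2) / 3 = 0 := by omega
      rw [h0]
      exact DT.zero _ _ _ hW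
    by_cases hout : ∃ v ∈ W, ¬ (a ≤ v.1.1 ∧ v.1.1 < b)
    · obtain ⟨v, hv, hvo⟩ := hout
      refine DT.step' hv hW ?_ ((b - 1 - (a + 1) + 2) / 3) (by omega) ?_
      · refine ih _ a b (by rw [Finset.card_erase_of_mem hv]; omega) ha hb ?_
        intro u h1 h2
        refine Finset.mem_erase.2 ⟨?_, hsub u h1 h2⟩
        rintro rfl
        exact hvo ⟨h1, h2⟩
      · intro W' hc hm
        refine ih _ (a + 1) (b - 1) hc (by omega) (by omega) ?_
        intro u h1 h2
        refine (hm u).2 ⟨hsub u (by omega) (by omega), ?_, ?_⟩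
        · rintro rfl
          exact hvo ⟨by omega, by omega⟩
        · rintro ⟨-, h3, -⟩
          have := u.1.2
          have := v.1.2
          omega
    · push Not at hout
      have hWm : ∀ v, v ∈ W ↔ a ≤ v.1.1 ∧ v.1.1 < b := fun v =>
        ⟨hout v, fun h => hsub v h.1 h.2⟩
      have han : a < n := by omega
      let v0 : Fin n × Fin 3 := (⟨a, han⟩, 0)
      let v1 : Fin n × Fin 3 := (⟨a, han⟩, 1)
      let v2 : Fin n × Fin 3 := (⟨a, han⟩, 2)
      let W3 := W.filter fun v => a + 2 ≤ v.1.1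
      have hv1 : v1 ∈ W := (hWm _).2 ⟨le_rfl, hab⟩
      have hcard : ∀ U : Finset (Fin n × Fin 3), U ⊆ W.erase v1 → U.card ≤ c := by
        intro U hU
        have := Finset.card_le_card hU
        rw [Finset.card_erase_of_mem hv1] at this
        omega
      have hW3 : DT (cAdj n 3) W3 ((b - (a + 2) + 2) / 3) := by
        refine ih _ _ _ (hcard _ ?_) (by omega) hb ?_
        · intro u hu
          obtain ⟨hu, hu2⟩ := Finset.mem_filter.1 hu
          refine Finset.mem_erase.2 ⟨?_, hu⟩
          rintro rfl
          simp [v1] at hu2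
        · intro u h1 h2
          exact Finset.mem_filter.2 ⟨hsub u (by omega) h2, h1⟩
      have far : ∀ (u v : Fin n × Fin 3), v.1.1 = a → a + 2 ≤ u.1.1 → ¬ cAdj n 3 u v := by
        rintro u v hv hu ⟨-, h, -⟩
        have := u.1.2
        omega
      have hW2 : DT (cAdj n 3) (insert v0 (insert v2 W3)) ((b - (a + 2) + 2) / 3 + 1 + 1) := by
        refine DT.iso ?_ ?_ (DT.iso ?_ ?_ hW3)
        · intro h
          rcases Finset.mem_insert.1 h with h | h
          · simp [v0, v2] at h
          · have := (Finset.mem_filter.1 h).2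
            simp [v0] at this
        · intro u hu
          rcases Finset.mem_insert.1 hu with rfl | h
          · rintro ⟨-, -, h⟩
            simp [v0, v2] at h
          · exact far u v0 rfl (Finset.mem_filter.1 h).2
        · intro h
          have := (Finset.mem_filter.1 h).2
          simp [v2] at this
        · intro u h
          exact far u v2 rfl (Finset.mem_filter.1 h).2
      let W1 := W.filter fun v => v.1.1 ≠ a + 1
      have hW1 : DT (cAdj n 3) W1 ((b - a + 2) / 3) := by
        refine DT.step' (v := v1) (c := c) (Finset.mem_filter.2 ⟨hv1, by simp [v1]⟩)
          ((Finset.card_filter_le _ _).trans hW) ?_ ((b - (a + 2) + 2) / 3) (by omega) ?_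
        · have : W1.erase v1 = insert v0 (insert v2 W3) := by
            ext u
            obtain ⟨⟨i, hi⟩, j⟩ := u
            simp only [W1, W3, Finset.mem_erase, Finset.mem_filter, Finset.mem_insert, hWm, v0, v1,
              v2, Prod.mk.injEq, Fin.mk.injEq, ne_eq]
            fin_cases j <;> simp <;> omega
          rw [this]
          exact DT.mono hW2 (by omega)
        · intro W' hc hm
          refine ih _ (a + 2) b hc (by omega) hb ?_
          intro u h1 h2
          refine (hm u).2 ⟨Finset.mem_filter.2 ⟨hsub u (by omega) h2, by omega⟩, ?_, ?_⟩
          · rintro rfl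
            simp [v1] at h1
          · exact far u v1 rfl h1
      have hT : ∀ T : Finset (Fin n × Fin 3), T ⊆ W.filter (fun v => v.1.1 = a + 1) →
          DT (cAdj n 3) (T ∪ W1) ((b - a + 2) / 3) := by
        intro T
        induction T using Finset.induction_on with
        | empty => intro _; rwa [Finset.empty_union]
        | insert v T hvT ihT =>
          intro hT
          have hvW := Finset.mem_filter.1 (hT (Finset.mem_insert_self v T))
          have hT' := ihT ((Finset.subset_insert _ _).trans hT)
          have hsubW : insert v T ∪ W1 ⊆ W :=
            Finset.union_subset (hT.trans (Finset.filter_subset _ _)) (Finset.filter_subset _ _)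
          refine DT.step' (v := v) (c := c)
            (Finset.mem_union_left _ (Finset.mem_insert_self v T))
            ((Finset.card_le_card hsubW).trans hW) ?_ ((b - (a + 3) + 2) / 3) (by omega) ?_
          · have : (insert v T ∪ W1).erase v = T ∪ W1 := by
              rw [Finset.insert_union, Finset.erase_insert]
              intro h
              rcases Finset.mem_union.1 h with h | h
              · exact hvT h
              · exact (Finset.mem_filter.1 h).2 hvW.2
            rw [this]
            exact hT'
          · intro W' hc hm
            refine ih _ (a + 3) b hc (by omega) hb ?_
            intro u h1 h2
            refine (hm u).2 ⟨Finset.mem_union_right _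
              (Finset.mem_filter.2 ⟨hsub u (by omega) h2, by omega⟩), ?_, ?_⟩
            · rintro rfl
              have := hvW.2
              omega
            · rintro ⟨-, h, -⟩
              have := hvW.2
              have := u.1.2
              omega
      have := hT _ (Finset.Subset.refl _)
      rwa [Finset.filter_union_filter_not_eq] at this

lemma dt_main (n : ℕ) (hn : 3 ≤ n) : DT (cAdj n 3) Finset.univ ((n - 1 + 2) / 3) :=
  dt_cols n _ Finset.univ 1 n le_rfl le_rfl le_rfl (fun v _ _ => Finset.mem_univ v)

/-- A small dominating independent set. -/
def domSet (n : ℕ) : Finset (Fin n × Fin 3) :=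
  Finset.univ.filter fun v => v.2 = 1 ∧
    ((v.1.1 % 3 = 0 ∧ v.1.1 + 3 ≤ n) ∨ (n % 3 ≠ 0 ∧ v.1.1 + 2 = n))

lemma mem_domSet {n : ℕ} {v : Fin n × Fin 3} : v ∈ domSet n ↔ v.2 = 1 ∧
    ((v.1.1 % 3 = 0 ∧ v.1.1 + 3 ≤ n) ∨ (n % 3 ≠ 0 ∧ v.1.1 + 2 = n)) := by
  simp [domSet]

lemma domSet_mem (n : ℕ) (hn : 3 ≤ n) : domSet n ∈ indCx (cAdj n 3) Finset.univ := by
  rw [mem_indCx]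
  refine ⟨Finset.subset_univ _, ?_⟩
  intro u hu v hv
  rw [mem_domSet] at hu hv
  rintro ⟨hne, h, -⟩
  have : u.1.1 ≠ v.1.1 := fun h => hne (Prod.ext (Fin.ext h) (hu.1.trans hv.1.symm))
  have := u.1.2
  have := v.1.2
  omega

lemma domSet_dom (n : ℕ) (hn : 3 ≤ n) (v : Fin n × Fin 3) (hv : v ∉ domSet n) :
    ∃ b ∈ domSet n, v ∉ (Finset.univ : Finset (Fin n × Fin 3)) ∨ cAdj n 3 v b := by
  have key : ∃ i : ℕ, i < n ∧ ((i % 3 = 0 ∧ i + 3 ≤ n) ∨ (n % 3 ≠ 0 ∧ i + 2 = n)) ∧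
      min ((v.1.1 : ℤ) - (i : ℤ)).natAbs (n - ((v.1.1 : ℤ) - (i : ℤ)).natAbs) ≤ 1 := by
    have hvn := v.1.2
    generalize v.1.1 = k at hvn
    by_cases h0 : k + 1 = n
    · by_cases h3 : n % 3 = 0
      · exact ⟨0, by omega, by omega, by omega⟩
      · exact ⟨n - 2, by omega, by omega, by omega⟩
    · by_cases h1 : ((k + 1) / 3 * 3) + 3 ≤ n
      · exact ⟨(k + 1) / 3 * 3, by omega, by omega, by omega⟩
      · exact ⟨n - 2, by omega, by omega, by omega⟩
  obtain ⟨i, hin, hi, hadj⟩ := key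
  refine ⟨(⟨i, hin⟩, 1), mem_domSet.2 ⟨rfl, hi⟩, Or.inr ⟨?_, hadj, ?_⟩⟩
  · rintro rfl
    exact hv (mem_domSet.2 ⟨rfl, hi⟩)
  · obtain ⟨i, j⟩ := v
    fin_cases j <;> simp

lemma domSet_card (n : ℕ) (hn : 3 ≤ n) : (domSet n).card ≤ (n + 2) / 3 := by
  have := Finset.card_le_card_of_injOn (s := domSet n) (t := Finset.range ((n + 2) / 3))
    (fun v => (v.1.1 + 2) / 3) ?_ ?_
  · rwa [Finset.card_range] at this
  · intro v hv
    have := (mem_domSet.1 hv).2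
    simp only [Finset.coe_range, Set.mem_Iio]
    omega
  · intro u hu v hv huv
    have hu := mem_domSet.1 hu
    have hv := mem_domSet.1 hv
    simp only at huv
    refine Prod.ext (Fin.ext ?_) (hu.1.trans hv.1.symm)
    omega

end comb

section depthUpper

lemma assoc_of_min {R M : Type} [CommRing R] [IsNoetherianRing R] [AddCommGroup M] [Module R M]
    (y : M) (m : Ideal R) [m.IsPrime] (h : ∀ r : R, r • y = 0 → r ∈ m) :
    ∃ Q : Ideal R, Q.IsPrime ∧ Q ≤ m ∧ (∀ r : R, r • y = 0 → r ∈ Q) ∧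
      ∃ z : M, ∀ r : R, r ∈ Q ↔ r • z = 0 := by
  let N := Submodule.span R {y}
  have hann : ∀ r : R, r ∈ Module.annihilator R N ↔ r • y = 0 := by
    intro r
    rw [Submodule.mem_annihilator]
    constructor
    · intro h; exact h y (Submodule.mem_span_singleton_self y)
    · intro h n hn
      obtain ⟨a, rfl⟩ := Submodule.mem_span_singleton.1 hn
      rw [smul_comm, h, smul_zero]
  obtain ⟨Q, hQ, hQm⟩ := Ideal.exists_minimalPrimes_le (I := Module.annihilator R N) (J := m)
    (fun r hr => h r ((hann r).1 hr))
  have hass := Module.associatedPrimes.minimalPrimes_annihilator_subset_associatedPrimes R N hQ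
  rw [AssociatedPrimes.mem_iff, isAssociatedPrime_iff] at hass
  obtain ⟨hp, z, hz⟩ := hass
  refine ⟨Q, hp, hQm, fun r hr => hQ.1.2 ((hann r).2 hr), z, fun r => ?_⟩
  rw [hz, Submodule.mem_colon_singleton, Submodule.mem_bot, ← Submodule.coe_smul,
    ZeroMemClass.coe_eq_zero]

lemma reg_step {R M : Type} [CommRing R] [IsNoetherianRing R] [AddCommGroup M] [Module R M]
    [Module.Finite R M] (m : Ideal R) [hm : m.IsMaximal] (P : Ideal R) (hPm : P ≤ m) (x : M)
    (hx : ∀ r : R, r ∈ P ↔ r • x = 0) (f : R) (hf : f ∈ m) (hreg : IsSMulRegular M f) :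
    ∃ Q : Ideal R, Q.IsPrime ∧ Q ≤ m ∧ P < Q ∧
      ∃ z : QuotSMulTop f M, ∀ r : R, r ∈ Q ↔ r • z = 0 := by
  let N : Submodule R M :=
    { carrier := {y | ∀ p ∈ P, p • y = 0}
      add_mem' := by
        intro a b ha hb p hp
        rw [smul_add, ha p hp, hb p hp, add_zero]
      zero_mem' := by intro p _; exact smul_zero p
      smul_mem' := by
        intro c a ha p hp
        rw [smul_comm, ha p hp, smul_zero] }
  have hxN : x ∈ N := fun p hp => (hx p).1 hp
  have hx0 : x ≠ 0 := by
    rintro rfl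
    have : (1 : R) ∈ P := (hx 1).2 (smul_zero _)
    exact hm.ne_top ((Ideal.eq_top_iff_one _).2 (hPm this))
  have key : ∃ y ∈ N, ∀ r : R, r • (Submodule.Quotient.mk y : QuotSMulTop f M) = 0 → r ∈ m := by
    by_contra! hcon
    have hle : N ≤ m • N := by
      intro y hy
      obtain ⟨r, hr, hrm⟩ := hcon y hy
      rw [← Submodule.Quotient.mk_smul, Submodule.Quotient.mk_eq_zero] at hr
      obtain ⟨z, -, hz⟩ := (Submodule.mem_smul_pointwise_iff_exists _ _ _).1 hr
      have hzN : z ∈ N := by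
        intro p hp
        apply hreg
        change f • p • z = f • (0 : M)
        rw [smul_zero, smul_comm, hz, smul_comm, hy p hp, smul_zero]
      obtain ⟨a, b, hb, hab⟩ := hm.exists_inv hrm
      have : y = f • (a • z) + b • y := by
        rw [smul_comm f a, hz, ← mul_smul, ← add_smul, hab, one_smul]
      rw [this]
      exact add_mem (Submodule.smul_mem_smul hf (N.smul_mem a hzN)) (Submodule.smul_mem_smul hb hy)
    obtain ⟨r, hr1, hr2⟩ := Submodule.exists_sub_one_mem_and_smul_eq_zero_of_fg_of_le_smul m N
      (IsNoetherian.noetherian N) hle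
    have hrm : r ∈ m := hPm ((hx r).2 (hr2 x hxN))
    apply hm.ne_top
    rw [Ideal.eq_top_iff_one]
    have := m.sub_mem hrm hr1
    rwa [sub_sub_cancel] at this
  obtain ⟨y, hyN, hy⟩ := key
  obtain ⟨Q, hQ, hQm, hQ1, hQ2⟩ := assoc_of_min _ m hy
  refine ⟨Q, hQ, hQm, ?_, hQ2⟩
  rw [SetLike.lt_iff_le_and_exists]
  refine ⟨fun p hp => hQ1 p ?_, f, hQ1 f ?_, fun hfP => ?_⟩
  · rw [← Submodule.Quotient.mk_smul, hyN p hp, Submodule.Quotient.mk_zero]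
  · rw [← Submodule.Quotient.mk_smul, Submodule.Quotient.mk_eq_zero]
    exact Submodule.smul_mem_pointwise_smul _ _ _ trivial
  · apply hx0
    apply hreg
    change f • x = f • (0 : M)
    rw [smul_zero, (hx f).1 hfP]

lemma reg_length_le {R : Type} [CommRing R] [IsNoetherianRing R] (m : Ideal R) [hm : m.IsMaximal]
    (I : Ideal R) : ∀ (rs : List R) (M : Type) [AddCommGroup M] [Module R M]
    [Module.Finite R M] (P : Ideal R) (hP : P.IsPrime) (hI : I ≤ P) (_ : P ≤ m) (x : M)
    (_ : ∀ r : R, r ∈ P ↔ r • x = 0) (_ : ∀ f ∈ rs, f ∈ m) (_ : IsRegular M rs),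
    (rs.length : ℕ∞) ≤ Order.coheight
      (⟨⟨P, hP⟩, hI⟩ : PrimeSpectrum.zeroLocus (R := R) (I : Set R)) := by
  intro rs
  induction rs with
  | nil => intros; simp
  | cons f rs ih =>
    intro M _ _ _ P hP hI hPm x hx hrs hreg
    rw [isRegular_cons_iff] at hreg
    obtain ⟨Q, hQ, hQm, hPQ, z, hz⟩ := reg_step m P hPm x hx f (hrs f (by simp)) hreg.1
    have h1 := ih (QuotSMulTop f M) Q hQ (hI.trans hPQ.le) hQm z hz
      (fun g hg => hrs g (List.mem_cons_of_mem _ hg)) hreg.2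
    have hlt : (⟨⟨P, hP⟩, hI⟩ : PrimeSpectrum.zeroLocus (R := R) (I : Set R)) <
        ⟨⟨Q, hQ⟩, hI.trans hPQ.le⟩ := hPQ
    have h2 := Order.coheight_add_one_le hlt
    rw [List.length_cons, Nat.cast_add, Nat.cast_one]
    exact (add_le_add_left h1 1).trans h2

lemma reg_length_le_dim {R : Type} [CommRing R] [IsNoetherianRing R] (m : Ideal R)
    [hm : m.IsMaximal] (I : Ideal R) (hIm : I ≤ m) (M : Type) [AddCommGroup M] [Module R M]
    [Module.Finite R M] (x : M) (hx : ∀ r : R, r ∈ I ↔ r • x = 0) (rs : List R)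
    (hrs : ∀ f ∈ rs, f ∈ m) (hreg : IsRegular M rs) :
    (rs.length : WithBot ℕ∞) ≤ ringKrullDim (R ⧸ I) := by
  obtain ⟨Q, hQ, hQm, hQ1, z, hz⟩ := assoc_of_min x m (fun r hr => hIm ((hx r).2 hr))
  have hIQ : I ≤ Q := fun r hr => hQ1 r ((hx r).1 hr)
  have h := reg_length_le m I rs M Q hQ hIQ hQm z hz hrs hreg
  rw [ringKrullDim_quotient]
  refine le_trans ?_ (Order.coheight_le_krullDim
    (⟨⟨Q, hQ⟩, hIQ⟩ : PrimeSpectrum.zeroLocus (R := R) (I : Set R)))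
  exact_mod_cast h

variable {K : Type} [Field K] {σ : Type}

lemma mIdeal_isMaximal : (mIdeal K σ).IsMaximal := by
  have h : mIdeal K σ = RingHom.ker (constantCoeff (σ := σ) (R := K)) := by
    ext p
    rw [mem_mIdeal, RingHom.mem_ker, constantCoeff_eq]
  rw [h]
  exact RingHom.ker_isMaximal_of_surjective _ (fun a => ⟨C a, constantCoeff_C _ a⟩)

lemma dim_le [DecidableEq σ] (D : Finset σ) :
    ringKrullDim (MvPolynomial σ K ⧸ srIdeal K (LowerSet.Iic D)) ≤ (D.card : WithBot ℕ∞) := by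
  let φ : MvPolynomial D K →+* (MvPolynomial σ K ⧸ srIdeal K (LowerSet.Iic D)) :=
    (Ideal.Quotient.mk _).comp (rename (Subtype.val : D → σ)).toRingHom
  have hφ : Function.Surjective φ := by
    rw [← RingHom.range_eq_top, eq_top_iff]
    rintro y -
    obtain ⟨p, rfl⟩ := Ideal.Quotient.mk_surjective y
    rw [RingHom.mem_range]
    induction p using MvPolynomial.induction_on with
    | C a => exact ⟨C a, by simp [φ]⟩
    | add p q hp hq =>
      obtain ⟨p', hp⟩ := hp
      obtain ⟨q', hq⟩ := hq
      exact ⟨p' + q', by rw [map_add, map_add, hp, hq]⟩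
    | mul_X p i hp =>
      obtain ⟨p', hp⟩ := hp
      by_cases hi : i ∈ D
      · exact ⟨p' * X ⟨i, hi⟩, by rw [map_mul, map_mul, hp]; simp [φ]⟩
      · refine ⟨0, ?_⟩
        rw [map_zero, map_mul]
        have : Ideal.Quotient.mk (srIdeal K (LowerSet.Iic D)) (X i) = 0 := by
          rw [Ideal.Quotient.eq_zero_iff_mem]
          intro u hu
          rw [coeff_X', if_neg]
          rintro rfl
          apply hi
          have : (Finsupp.single i 1).support ≤ D := hu
          exact this (by simp)
        rw [this, mul_zero]
  refine (ringKrullDim_le_of_surjective φ hφ).trans ?_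
  rw [MvPolynomial.ringKrullDim_of_isNoetherianRing, ringKrullDim_eq_zero_of_field]
  simp

lemma regSeq_le [Finite σ] [DecidableEq σ] {Adj : σ → σ → Prop} {W : Finset σ} {D : Finset σ}
    (hD : D ∈ indCx Adj W) (hmax : ∀ a, a ∉ D → ∃ b ∈ D, a ∉ W ∨ Adj a b)
    (rs : List (MvPolynomial σ K)) (hrs : ∀ f ∈ rs, f ∈ mIdeal K σ)
    (hreg : IsRegular (MvPolynomial σ K ⧸ srIdeal K (indCx Adj W)) rs) :
    rs.length ≤ D.card := by
  haveI : (mIdeal K σ).IsMaximal := mIdeal_isMaximal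
  let d : σ →₀ ℕ := Finsupp.onFinset D (fun x => if x ∈ D then 1 else 0) (by
    intro a ha; by_contra h; simp [h] at ha)
  have hd : d.support = D := by
    ext a
    simp [d]
  have h := reg_length_le_dim (mIdeal K σ) (srIdeal K (LowerSet.Iic D)) ?_
    (MvPolynomial σ K ⧸ srIdeal K (indCx Adj W)) (Ideal.Quotient.mk _ (monomial d 1)) ?_ rs hrs hreg
  · have := h.trans (dim_le D)
    exact_mod_cast this
  · intro p hp
    rw [mem_mIdeal]
    exact hp 0 (by simp)
  · intro p
    change _ ↔ Ideal.Quotient.mk _ (p * monomial d 1) = 0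
    rw [Ideal.Quotient.eq_zero_iff_mem, mem_srIdeal, mem_srIdeal]
    constructor
    · intro h u hu
      rw [coeff_mul_monomial']
      split_ifs with hdu
      · rw [mul_one]
        apply h
        change (u - d).support ⊆ D
        intro a ha
        by_contra haD
        obtain ⟨b, hb, hab⟩ := hmax a haD
        have hau : a ∈ u.support := by
          rw [Finsupp.mem_support_iff] at ha ⊢
          intro h0
          rw [Finsupp.tsub_apply, h0] at ha
          simp at ha
        have hbu : b ∈ u.support := by
          rw [← hd] at hb
          rw [Finsupp.mem_support_iff] at hb ⊢
          have := hdu b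
          omega
        rcases hab with hab | hab
        · exact hab (hu.1 hau)
        · exact hu.2 a hau b hbu hab
      · rfl
    · intro h u hu
      have h1 := h (u + d) ((indCx Adj W).lower (a := D) ?_ hD)
      · rwa [coeff_mul_monomial, mul_one] at h1
      · refine Finsupp.support_add.trans (Finset.union_subset hu hd.le)

end depthUpper

section final
variable {K : Type} [Field K] {σ : Type} [Fintype σ] [DecidableEq σ] {Adj : σ → σ → Prop}

lemma depth_bounds (hs : ∀ a b, Adj a b → Adj b a) (hi : ∀ a, ¬ Adj a a) {t : ℕ}
    (ht : DT Adj Finset.univ t) {D : Finset σ} (hD : D ∈ indCx Adj Finset.univ)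
    (hmax : ∀ a, a ∉ D → ∃ b ∈ D, a ∉ (Finset.univ : Finset σ) ∨ Adj a b) :
    (t ≤ rdepth K σ (MvPolynomial σ K ⧸ edgeIdeal K Adj) ∧
      rdepth K σ (MvPolynomial σ K ⧸ edgeIdeal K Adj) ≤ D.card) ∧
    (t ≤ sdepth K σ (MvPolynomial σ K ⧸ edgeIdeal K Adj) ∧
      sdepth K σ (MvPolynomial σ K ⧸ edgeIdeal K Adj) ≤ D.card) := by
  rw [edgeIdeal_eq hi]
  have hr : D.card ∈ upperBounds { d | ∃ rs : List (MvPolynomial σ K), rs.length = d ∧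
      (∀ f ∈ rs, f ∈ Ideal.span (Set.range (X : σ → MvPolynomial σ K))) ∧
      IsRegular (MvPolynomial σ K ⧸ srIdeal K (indCx Adj Finset.univ)) rs } := by
    rintro _ ⟨rs, rfl, h1, h2⟩
    exact regSeq_le hD hmax rs h1 h2
  have hsd : D.card ∈ upperBounds { d | ∃ r,
      ∃ w : Fin r → (MvPolynomial σ K ⧸ srIdeal K (indCx Adj Finset.univ)),
      ∃ A : Fin r → Finset σ,
      IsStanleyDecomp K σ (MvPolynomial σ K ⧸ srIdeal K (indCx Adj Finset.univ)) w A ∧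
        d = sInf (Set.range fun i => (A i).card) } := by
    rintro _ ⟨r, w, A, H, rfl⟩
    exact stanley_le hD hmax H
  refine ⟨⟨?_, csSup_le' hr⟩, ?_, csSup_le' hsd⟩
  · exact le_csSup ⟨_, hr⟩ (ht.hasReg hs hi)
  · obtain ⟨r, w, A, H, hle⟩ := (ht.cd hs hi).stanley (K := K)
    exact hle.trans (le_csSup ⟨_, hsd⟩ ⟨r, w, A, H, rfl⟩)

end final

end Main

/-- Let `n ≥ 3`. If `n ≡ 0, 2 (mod 3)` then
`depth(S_{n,3}/I(C_{n,3})) = sdepth(S_{n,3}/I(C_{n,3})) = ⌈(n−1)/3⌉`; if `n ≡ 1 (mod 3)`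
then `⌈(n−1)/3⌉ ≤ depth(S_{n,3}/I(C_{n,3})), sdepth(S_{n,3}/I(C_{n,3})) ≤ ⌈n/3⌉`. -/
theorem depth_sdepth_quotient_edgeIdeal_C_n_3 (K : Type) [Field K] (n : ℕ) (hn : 3 ≤ n) :
    (n % 3 = 0 ∨ n % 3 = 2 →
      rdepth K (Fin n × Fin 3)
          (MvPolynomial (Fin n × Fin 3) K ⧸ edgeIdeal K (cAdj n 3)) = (n - 1 + 2) / 3 ∧
      sdepth K (Fin n × Fin 3)
          (MvPolynomial (Fin n × Fin 3) K ⧸ edgeIdeal K (cAdj n 3)) = (n - 1 + 2) / 3) ∧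
    (n % 3 = 1 →
      ((n - 1 + 2) / 3 ≤ rdepth K (Fin n × Fin 3)
          (MvPolynomial (Fin n × Fin 3) K ⧸ edgeIdeal K (cAdj n 3)) ∧
        rdepth K (Fin n × Fin 3)
          (MvPolynomial (Fin n × Fin 3) K ⧸ edgeIdeal K (cAdj n 3)) ≤ (n + 2) / 3) ∧
      ((n - 1 + 2) / 3 ≤ sdepth K (Fin n × Fin 3)
          (MvPolynomial (Fin n × Fin 3) K ⧸ edgeIdeal K (cAdj n 3)) ∧
        sdepth K (Fin n × Fin 3)
          (MvPolynomial (Fin n × Fin 3) K ⧸ edgeIdeal K (cAdj n 3)) ≤ (n + 2) / 3)) := by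
  obtain ⟨⟨h1, h2⟩, h3, h4⟩ := depth_bounds (K := K) (cAdj_symm n) (cAdj_irrefl n) (dt_main n hn)
    (domSet_mem n hn) (domSet_dom n hn)
  have hc := domSet_card n hn
  constructor
  · intro h
    constructor <;> omega
  · intro h
    exact ⟨⟨h1, h2.trans hc⟩, h3, h4.trans hc⟩
end

section
/- Let A and B be two disjoint finite sets of variables, and let I_1 ⊂ K[A] and I_2 ⊂ K[B] be squarefree monomial ideals such that sdepth_{K[A]}(I_1) > sdepth(K[A]/I_1). Then sdepth_{K[A∪B]}((I_1 + I_2)K[A∪B]) ≥ sdepth(K[A]/I_1) + sdepth_{K[B]}(I_2). -/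
open MvPolynomial

/-- `I` is a squarefree monomial ideal: it is generated by squarefree monomials. -/
def IsSquarefreeMonomialIdeal {K : Type} [Field K] {σ : Type}
    (I : Ideal (MvPolynomial σ K)) : Prop :=
  ∃ G : Set (σ →₀ ℕ), (∀ u ∈ G, ∀ s, u s ≤ 1) ∧
    I = Ideal.span ((fun u => (monomial u (1 : K) : MvPolynomial σ K)) '' G)

open TensorProduct in
theorem li_sumElim_of_map {K V W ι κ : Type} [Field K] [AddCommGroup V] [Module K V]
    [AddCommGroup W] [Module K W] (φ : V →ₗ[K] W) {f : ι → V} {g : κ → V}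
    (hf : LinearIndependent K f) (h0 : ∀ i, φ (f i) = 0) (hg : LinearIndependent K (φ ∘ g)) :
    LinearIndependent K (Sum.elim f g) := by
  refine hf.sum_type (LinearIndependent.of_comp φ hg) ?_
  have h1 : Submodule.span K (Set.range f) ≤ LinearMap.ker φ := by
    rw [Submodule.span_le]; rintro _ ⟨i, rfl⟩; exact h0 i
  exact ((Submodule.range_ker_disjoint hg).symm).mono_left h1

/-- Index set of the monomial basis attached to a Stanley decomposition. -/
abbrev SIdx {σ ι : Type} (A : ι → Finset σ) : Type :=
  Σ i, {u : σ →₀ ℕ // (↑u.support : Set σ) ⊆ ↑(A i)}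

section Gen

set_option linter.unusedSectionVars false

variable (K : Type) [Field K] (σ : Type)
variable (M : Type) [AddCommGroup M] [Module K M] [Module (MvPolynomial σ K) M]
  [IsScalarTower K (MvPolynomial σ K) M]

/-- The family of monomial multiples. -/
noncomputable def sFam {ι : Type} (w : ι → M) (A : ι → Finset σ) : SIdx A → M :=
  fun p => (monomial p.2.1 (1 : K) : MvPolynomial σ K) • w p.1

/-- Basis form of a Stanley decomposition. -/
def SBasis {ι : Type} (w : ι → M) (A : ι → Finset σ) : Prop :=
  LinearIndependent K (sFam K σ M w A) ∧ Submodule.span K (Set.range (sFam K σ M w A)) = ⊤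

theorem stanleySpace_eq_s7 {ι : Type} (w : ι → M) (A : ι → Finset σ) (i : ι) :
    stanleySpace K σ M (w i) (A i) =
      Submodule.span K (Set.range fun u : {u : σ →₀ ℕ // (↑u.support : Set σ) ⊆ ↑(A i)} =>
        (monomial u.1 (1 : K) : MvPolynomial σ K) • w i) := by
  unfold stanleySpace
  congr 1
  ext m
  constructor
  · rintro ⟨u, hu, rfl⟩; exact ⟨⟨u, hu⟩, rfl⟩
  · rintro ⟨⟨u, hu⟩, rfl⟩; exact ⟨u, hu, rfl⟩

theorem sum_smul_eq (f : MvPolynomial σ K) (w : M) :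
    f • w = ∑ u ∈ f.support, f.coeff u • ((monomial u (1 : K) : MvPolynomial σ K) • w) := by
  conv_lhs => rw [f.as_sum, Finset.sum_smul]
  refine Finset.sum_congr rfl fun u _ => ?_
  rw [← smul_assoc, smul_monomial, smul_eq_mul, mul_one]

theorem free_iff (w : M) (A : Finset σ) :
    (∀ f : MvPolynomial σ K, (↑f.vars : Set σ) ⊆ ↑A → f • w = 0 → f = 0) ↔
    LinearIndependent K (fun u : {u : σ →₀ ℕ // (↑u.support : Set σ) ⊆ ↑A} =>
        (monomial u.1 (1 : K) : MvPolynomial σ K) • w) := by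
  classical
  constructor
  · intro h
    rw [linearIndependent_iff']
    intro s g hg i hi
    let f : MvPolynomial σ K := ∑ u ∈ s, monomial u.1 (g u)
    have hfw : f • w = 0 := by
      rw [← hg, Finset.sum_smul]
      refine Finset.sum_congr rfl fun u _ => ?_
      rw [← smul_assoc, smul_monomial, smul_eq_mul, mul_one]
    have hfv : (↑f.vars : Set σ) ⊆ ↑A := by
      intro x hx
      have := vars_sum_subset s (fun u => (monomial u.1 (g u) : MvPolynomial σ K)) hx
      rw [Finset.mem_biUnion] at this
      obtain ⟨u, _, hu⟩ := this
      by_cases h0 : g u = 0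
      · simp [h0] at hu
      · rw [vars_monomial h0] at hu
        exact u.2 hu
    have hf := h f hfv hfw
    have : coeff i.1 f = 0 := by rw [hf]; simp
    rw [coeff_sum, Finset.sum_eq_single i] at this
    · simpa using this
    · intro b _ hb
      rw [coeff_monomial, if_neg]
      exact fun hh => hb (Subtype.ext hh)
    · exact fun hh => absurd hi hh
  · intro h f hf hfw
    rw [sum_smul_eq] at hfw
    have hsub : ∀ u ∈ f.support, (↑u.support : Set σ) ⊆ ↑A := by
      intro u hu x hx
      exact hf ((mem_vars_iff_mem_support x).2 ⟨u, hu, hx⟩)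
    rw [linearIndependent_iff'] at h
    rw [← Finset.sum_attach] at hfw
    let e : f.support → {u : σ →₀ ℕ // (↑u.support : Set σ) ⊆ ↑A} :=
      fun u => ⟨u.1, hsub u.1 u.2⟩
    have he : Function.Injective e := by
      intro a b hab
      exact Subtype.ext (congrArg (fun z => z.1) hab)
    have := h (f.support.attach.map ⟨e, he⟩) (fun u => f.coeff u.1) (by
      rw [Finset.sum_map]; exact hfw)
    ext u
    by_cases hu : u ∈ f.support
    · have := this (e ⟨u, hu⟩) (Finset.mem_map.2 ⟨⟨u, hu⟩, Finset.mem_attach _ _, rfl⟩)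
      simpa using this
    · simpa using hu

theorem sbasis_of_decomp {r : ℕ} (w : Fin r → M) (A : Fin r → Finset σ)
    (h : IsStanleyDecomp K σ M w A) : SBasis K σ M w A := by
  obtain ⟨h1, h2, h3⟩ := h
  have hli := fun i => (free_iff K σ M (w i) (A i)).1 (h1 i)
  have heq : (fun i => stanleySpace K σ M (w i) (A i)) = fun i => Submodule.span K (Set.range
      fun u : {u : σ →₀ ℕ // (↑u.support : Set σ) ⊆ ↑(A i)} =>
        (monomial u.1 (1 : K) : MvPolynomial σ K) • w i) := by
    funext i; exact stanleySpace_eq_s7 K σ M w A i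
  rw [heq] at h2 h3
  have hint := (DirectSum.isInternal_submodule_iff_iSupIndep_and_iSup_eq_top _).2 ⟨h2, h3⟩
  let b := hint.collectedBasis (fun i => Module.Basis.span (hli i))
  have hb : (b : SIdx A → M) = sFam K σ M w A := by
    funext p
    simp only [b, DirectSum.IsInternal.collectedBasis_coe]
    rw [Module.Basis.span_apply]
    rfl
  exact ⟨hb ▸ b.linearIndependent, hb ▸ b.span_eq⟩

theorem decomp_of_sbasis {r : ℕ} (w : Fin r → M) (A : Fin r → Finset σ)
    (h : SBasis K σ M w A) : IsStanleyDecomp K σ M w A := by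
  obtain ⟨h1, h2⟩ := h
  have hsp : ∀ i, stanleySpace K σ M (w i) (A i) =
      Submodule.span K (sFam K σ M w A '' {p | p.1 = i}) := by
    intro i
    rw [stanleySpace_eq_s7]
    congr 1
    ext m
    constructor
    · rintro ⟨u, rfl⟩; exact ⟨⟨i, u⟩, rfl, rfl⟩
    · rintro ⟨⟨j, u⟩, hj, rfl⟩
      obtain rfl : j = i := hj
      exact ⟨u, rfl⟩
  refine ⟨fun i => (free_iff K σ M (w i) (A i)).2 ?_, ?_, ?_⟩
  · exact h1.comp (fun u => (⟨i, u⟩ : SIdx A)) (fun a b hab => by simpa using hab)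
  · intro i
    have : (⨆ j, ⨆ (_ : j ≠ i), stanleySpace K σ M (w j) (A j)) ≤
        Submodule.span K (sFam K σ M w A '' {p | p.1 ≠ i}) := by
      refine iSup₂_le fun j hj => ?_
      rw [hsp]
      refine Submodule.span_mono (Set.image_mono ?_)
      intro p hp
      have : p.1 = j := hp
      simpa [this] using hj
    refine Disjoint.mono_right this ?_
    simp only [hsp]
    refine h1.disjoint_span_image ?_
    rw [Set.disjoint_left]
    intro p hp hp'
    exact hp' hp
  · rw [eq_top_iff, ← h2, Submodule.span_le]
    rintro _ ⟨p, rfl⟩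
    refine Submodule.mem_iSup_of_mem p.1 ?_
    rw [hsp]
    exact Submodule.subset_span ⟨p, rfl, rfl⟩

theorem sbasis_reindex {ι κ : Type} (e : κ ≃ ι) (w : ι → M) (A : ι → Finset σ)
    (h : SBasis K σ M w A) : SBasis K σ M (w ∘ e) (A ∘ e) := by
  have hE : sFam K σ M (w ∘ e) (A ∘ e) = sFam K σ M w A ∘
      (fun p : SIdx (A ∘ e) => (⟨e p.1, p.2⟩ : SIdx A)) := rfl
  have hb : Function.Bijective (fun p : SIdx (A ∘ e) => (⟨e p.1, p.2⟩ : SIdx A)) := by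
    constructor
    · rintro ⟨a, u⟩ ⟨b, v⟩ hab
      simp only [Sigma.mk.injEq] at hab
      obtain ⟨h1, h2⟩ := hab
      obtain rfl := e.injective h1
      simpa using h2
    · rintro ⟨i, u⟩
      obtain ⟨k, rfl⟩ := e.surjective i
      exact ⟨⟨k, u⟩, rfl⟩
  refine ⟨?_, ?_⟩
  · rw [hE]; exact h.1.comp _ hb.1
  · rw [hE, hb.2.range_comp]; exact h.2

variable [Fintype σ]

theorem sdepth_bdd : ∀ d ∈ { d | ∃ r, ∃ w : Fin r → M, ∃ A : Fin r → Finset σ,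
    IsStanleyDecomp K σ M w A ∧ d = sInf (Set.range fun i => (A i).card) },
    d ≤ Fintype.card σ := by
  rintro d ⟨r, w, A, _, rfl⟩
  rcases Nat.eq_zero_or_pos r with rfl | hr
  · simp
  · exact (Nat.sInf_le (Set.mem_range_self (⟨0, hr⟩ : Fin r))).trans (Finset.card_le_univ _)

theorem sdepth_le_card : sdepth K σ M ≤ Fintype.card σ := by
  unfold sdepth
  rcases Set.eq_empty_or_nonempty { d | ∃ r, ∃ w : Fin r → M, ∃ A : Fin r → Finset σ,
    IsStanleyDecomp K σ M w A ∧ d = sInf (Set.range fun i => (A i).card) } with h | h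
  · rw [h]; simp
  · exact csSup_le h (sdepth_bdd K σ M)

theorem le_sdepth {ι : Type} [Fintype ι] [Nonempty ι] (w : ι → M) (A : ι → Finset σ)
    (h : SBasis K σ M w A) (d : ℕ) (hd : ∀ i, d ≤ (A i).card) : d ≤ sdepth K σ M := by
  let e := (Fintype.equivFin ι).symm
  have h' := decomp_of_sbasis K σ M _ _ (sbasis_reindex K σ M e w A h)
  have hne : (Set.range fun i => ((A ∘ e) i).card).Nonempty := by
    obtain ⟨i⟩ := ‹Nonempty ι›
    exact ⟨_, ⟨e.symm i, rfl⟩⟩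
  calc d ≤ sInf (Set.range fun i => ((A ∘ e) i).card) := by
        refine le_csInf hne ?_
        rintro _ ⟨i, rfl⟩; exact hd _
    _ ≤ _ := le_csSup ⟨_, sdepth_bdd K σ M⟩ ⟨_, _, _, h', rfl⟩

theorem sdepth_attained {ι : Type} [Fintype ι] (w : ι → M) (A : ι → Finset σ)
    (h : SBasis K σ M w A) : ∃ r, ∃ w : Fin r → M, ∃ A : Fin r → Finset σ,
      SBasis K σ M w A ∧ (∀ i, sdepth K σ M ≤ (A i).card) ∧ (0 < sdepth K σ M → 0 < r) := by
  let e := (Fintype.equivFin ι).symm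
  have h' := decomp_of_sbasis K σ M _ _ (sbasis_reindex K σ M e w A h)
  have hmem : sdepth K σ M ∈ { d | ∃ r, ∃ w : Fin r → M, ∃ A : Fin r → Finset σ,
    IsStanleyDecomp K σ M w A ∧ d = sInf (Set.range fun i => (A i).card) } :=
    Nat.sSup_mem ⟨_, _, _, _, h', rfl⟩ ⟨_, sdepth_bdd K σ M⟩
  obtain ⟨r, w, A, hw, hd⟩ := hmem
  refine ⟨r, w, A, sbasis_of_decomp K σ M w A hw, ?_, ?_⟩
  · intro i; rw [hd]; exact Nat.sInf_le ⟨i, rfl⟩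
  · intro hp
    rcases Nat.eq_zero_or_pos r with rfl | hr
    · rw [hd] at hp; simp at hp
    · exact hr

end Gen

theorem span_top_of_inj {K V W ι : Type} [Field K] [AddCommGroup V] [Module K V]
    [AddCommGroup W] [Module K W] (φ : V →ₗ[K] W) (hφ : Function.Injective φ) (v : ι → V)
    (h : ∀ x, φ x ∈ Submodule.span K (Set.range (φ ∘ v))) :
    Submodule.span K (Set.range v) = ⊤ := by
  rw [eq_top_iff]
  intro x _
  have := h x
  rw [Set.range_comp, Submodule.span_image] at this
  obtain ⟨y, hy, hxy⟩ := this
  rwa [← hφ hxy]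

section Exist

set_option linter.unusedSectionVars false

variable {K : Type} [Field K] {σ : Type} [Fintype σ]

/-- Exponent of the squarefree monomial with support `F`. -/
noncomputable def indF (F : Finset σ) : σ →₀ ℕ := Finsupp.indicator F (fun _ _ => 1)

theorem indF_apply_mem {F : Finset σ} {s : σ} (h : s ∈ F) : indF F s = 1 := by
  simp [indF, Finsupp.indicator_of_mem h]

theorem indF_apply_notMem {F : Finset σ} {s : σ} (h : s ∉ F) : indF F s = 0 := by
  simp [indF, Finsupp.indicator_of_notMem h]

theorem support_add_indF {F : Finset σ} {u : σ →₀ ℕ} (h : (↑u.support : Set σ) ⊆ ↑F) :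
    (u + indF F).support = F := by
  ext s
  by_cases hs : s ∈ F
  · simp [hs, indF_apply_mem hs]
  · have : u s = 0 := by
      by_contra h0
      exact hs (h (by simpa using h0))
    simp [hs, indF_apply_notMem hs, this]

theorem exists_add_indF (u : σ →₀ ℕ) :
    ∃ v : σ →₀ ℕ, (↑v.support : Set σ) ⊆ ↑u.support ∧ v + indF u.support = u := by
  refine ⟨u - indF u.support, ?_, ?_⟩
  · intro s hs
    simp only [Finset.mem_coe, Finsupp.mem_support_iff, Finsupp.tsub_apply] at hs ⊢
    omega
  · refine tsub_add_cancel_of_le ?_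
    intro s
    by_cases hs : s ∈ u.support
    · rw [indF_apply_mem hs]
      exact Nat.one_le_iff_ne_zero.2 (by simpa using hs)
    · rw [indF_apply_notMem hs]; exact Nat.zero_le _

theorem sq_facts {I : Ideal (MvPolynomial σ K)} (hI : IsSquarefreeMonomialIdeal I) :
    (∀ p ∈ I, ∀ u ∈ p.support, (monomial u (1 : K) : MvPolynomial σ K) ∈ I) ∧
    (∀ u : σ →₀ ℕ, (monomial u (1 : K) : MvPolynomial σ K) ∈ I ↔
      (monomial (indF u.support) (1 : K) : MvPolynomial σ K) ∈ I) := by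
  classical
  obtain ⟨G, hG, rfl⟩ := hI
  have key : ∀ u : σ →₀ ℕ, (monomial u (1 : K) : MvPolynomial σ K) ∈
      Ideal.span ((fun u => (monomial u (1 : K) : MvPolynomial σ K)) '' G) ↔ ∃ g ∈ G, g ≤ u := by
    intro u
    rw [mem_ideal_span_monomial_image, support_monomial, if_neg one_ne_zero]
    simp
  refine ⟨fun p hp u hu => ?_, fun u => ?_⟩
  · rw [key]; exact mem_ideal_span_monomial_image.1 hp u hu
  · rw [key, key]
    refine exists_congr fun g => and_congr_right fun hg => ?_
    rw [Finsupp.le_def, Finsupp.le_def]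
    refine forall_congr' fun s => ?_
    have := hG g hg s
    by_cases hs : s ∈ u.support
    · rw [indF_apply_mem hs]
      have : u s ≠ 0 := by simpa using hs
      omega
    · rw [indF_apply_notMem hs]
      have : u s = 0 := by simpa using hs
      omega

theorem eIdx_inj {P : Finset σ → Prop} :
    Function.Injective (fun p : SIdx (fun F : {F : Finset σ // P F} => F.1) =>
      p.2.1 + indF p.1.1) := by
  rintro ⟨⟨F, hF⟩, ⟨u, hu⟩⟩ ⟨⟨F', hF'⟩, ⟨u', hu'⟩⟩ h
  simp only at h hu hu'
  have h1 := congrArg Finsupp.support h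
  rw [support_add_indF hu, support_add_indF hu'] at h1
  subst h1
  have := add_right_cancel h
  subst this
  rfl

theorem exists_sbasis_ideal {I : Ideal (MvPolynomial σ K)} (hI : IsSquarefreeMonomialIdeal I) :
    ∃ (ι : Type) (_ : Fintype ι) (w : ι → I) (A : ι → Finset σ), SBasis K σ I w A := by
  classical
  obtain ⟨h1, h2⟩ := sq_facts hI
  refine ⟨{F : Finset σ // (monomial (indF F) (1 : K) : MvPolynomial σ K) ∈ I},
    Fintype.ofFinite _, fun F => ⟨_, F.2⟩, fun F => F.1, ?_⟩
  set w : {F : Finset σ // (monomial (indF F) (1 : K) : MvPolynomial σ K) ∈ I} → I :=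
    fun F => ⟨_, F.2⟩
  have hE : (I.subtype.restrictScalars K) ∘ sFam K σ I w (fun F => F.1) =
      (basisMonomials σ K) ∘ (fun p : SIdx (fun F : {F : Finset σ //
        (monomial (indF F) (1 : K) : MvPolynomial σ K) ∈ I} => F.1) => p.2.1 + indF p.1.1) := by
    funext p
    simp [sFam, w, monomial_mul]
  refine ⟨?_, ?_⟩
  · refine LinearIndependent.of_comp (I.subtype.restrictScalars K) ?_
    rw [hE]
    exact (basisMonomials σ K).linearIndependent.comp _ eIdx_inj
  · refine span_top_of_inj (I.subtype.restrictScalars K) Subtype.val_injective _ ?_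
    rintro ⟨x, hx⟩
    change x ∈ _
    rw [x.as_sum]
    refine Submodule.sum_mem _ fun u hu => ?_
    have hm : (monomial u (coeff u x) : MvPolynomial σ K) = coeff u x • monomial u (1 : K) := by
      simp [smul_monomial]
    rw [hm]
    refine Submodule.smul_mem _ _ (Submodule.subset_span ?_)
    rw [hE]
    obtain ⟨v, hv, hvu⟩ := exists_add_indF u
    exact ⟨⟨⟨u.support, (h2 u).1 (h1 x hx u hu)⟩, ⟨v, hv⟩⟩, by simp [hvu]⟩

theorem exists_sbasis_quot {I : Ideal (MvPolynomial σ K)} (hI : IsSquarefreeMonomialIdeal I) :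
    ∃ (ι : Type) (_ : Fintype ι) (w : ι → MvPolynomial σ K ⧸ I) (A : ι → Finset σ),
      SBasis K σ (MvPolynomial σ K ⧸ I) w A := by
  classical
  obtain ⟨h1, h2⟩ := sq_facts hI
  refine ⟨{F : Finset σ // (monomial (indF F) (1 : K) : MvPolynomial σ K) ∉ I},
    Fintype.ofFinite _, fun F => Ideal.Quotient.mk I (monomial (indF F.1) 1), fun F => F.1, ?_⟩
  set w : {F : Finset σ // (monomial (indF F) (1 : K) : MvPolynomial σ K) ∉ I} →
      MvPolynomial σ K ⧸ I := fun F => Ideal.Quotient.mk I (monomial (indF F.1) 1)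
  let e := (fun p : SIdx (fun F : {F : Finset σ //
        (monomial (indF F) (1 : K) : MvPolynomial σ K) ∉ I} => F.1) => p.2.1 + indF p.1.1)
  let φ : MvPolynomial σ K →ₗ[K] MvPolynomial σ K ⧸ I := (Ideal.Quotient.mkₐ K I).toLinearMap
  have hE : sFam K σ (MvPolynomial σ K ⧸ I) w (fun F => F.1) =
      φ ∘ ((basisMonomials σ K) ∘ e) := by
    funext p
    have : (monomial (p.2.1 + indF p.1.1) (1 : K) : MvPolynomial σ K) =
      monomial p.2.1 1 * monomial (indF p.1.1) 1 := by simp [monomial_mul]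
    simp only [Function.comp, coe_basisMonomials, e, this]
    rfl
  have hout : ∀ p, (monomial (e p) (1 : K) : MvPolynomial σ K) ∉ I := by
    intro p hp
    rw [h2, support_add_indF p.2.2] at hp
    exact p.1.2 hp
  refine ⟨?_, ?_⟩
  · rw [hE]
    refine ((basisMonomials σ K).linearIndependent.comp e eIdx_inj).map ?_
    rw [Submodule.disjoint_def]
    intro x hx hxI
    have hxI : x ∈ I := Ideal.Quotient.eq_zero_iff_mem.1 hxI
    have hsupp : x ∈ restrictSupport K (Set.range e) := by
      have hle : Submodule.span K (Set.range ((basisMonomials σ K) ∘ e)) ≤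
          restrictSupport K (Set.range e) := by
        rw [Submodule.span_le]
        rintro _ ⟨p, rfl⟩
        simp only [SetLike.mem_coe, mem_restrictSupport_iff, Function.comp, coe_basisMonomials]
        intro u hu
        have := support_monomial_subset hu
        simp only [Finset.mem_singleton] at this
        exact ⟨p, this.symm⟩
      exact hle hx
    rw [mem_restrictSupport_iff] at hsupp
    by_contra hx0
    obtain ⟨u, hu⟩ := (support_nonempty.2 hx0)
    obtain ⟨p, hp⟩ := hsupp hu
    exact hout p (hp ▸ h1 x hxI u hu)
  · rw [hE, eq_top_iff]
    intro y _
    obtain ⟨x, rfl⟩ := Ideal.Quotient.mk_surjective y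
    change φ x ∈ _
    rw [x.as_sum, map_sum]
    refine Submodule.sum_mem _ fun u hu => ?_
    have hm : (monomial u (coeff u x) : MvPolynomial σ K) = coeff u x • monomial u (1 : K) := by
      simp [smul_monomial]
    rw [hm, map_smul]
    refine Submodule.smul_mem _ _ ?_
    by_cases hmem : (monomial u (1 : K) : MvPolynomial σ K) ∈ I
    · have : φ (monomial u 1) = 0 := Ideal.Quotient.eq_zero_iff_mem.2 hmem
      rw [this]; exact Submodule.zero_mem _
    · refine Submodule.subset_span ?_
      obtain ⟨v, hv, hvu⟩ := exists_add_indF u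
      exact ⟨⟨⟨u.support, fun hh => hmem ((h2 u).2 hh)⟩, ⟨v, hv⟩⟩, by simp [e, hvu]⟩

end Exist

theorem bil_mem {K V W U ι κ : Type} [Field K] [AddCommGroup V] [Module K V]
    [AddCommGroup W] [Module K W] [AddCommGroup U] [Module K U] (f : V →ₗ[K] W →ₗ[K] U)
    (v : ι → V) (w : κ → W) (S : Submodule K U) (h : ∀ i j, f (v i) (w j) ∈ S)
    {p : V} {q : W} (hp : p ∈ Submodule.span K (Set.range v))
    (hq : q ∈ Submodule.span K (Set.range w)) : f p q ∈ S := by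
  have h1 := Submodule.apply_mem_map₂ f hp hq
  rw [Submodule.map₂_span_span] at h1
  refine (Submodule.span_le.2 ?_) h1
  rintro _ ⟨_, ⟨i, rfl⟩, _, ⟨j, rfl⟩, rfl⟩
  exact h i j

section Prod

set_option linter.unusedSectionVars false

open TensorProduct

variable (K : Type) [Field K] (α β : Type)

/-- The product of a polynomial in the first and one in the second set of variables. -/
noncomputable def mm : MvPolynomial α K →ₗ[K] MvPolynomial β K →ₗ[K] MvPolynomial (α ⊕ β) K :=
  (LinearMap.mul K (MvPolynomial (α ⊕ β) K)).compl₁₂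
    (rename (R := K) (Sum.inl : α → α ⊕ β)).toLinearMap
    (rename (R := K) (Sum.inr : β → α ⊕ β)).toLinearMap

theorem mm_apply (p : MvPolynomial α K) (q : MvPolynomial β K) :
    mm K α β p q = rename Sum.inl p * rename Sum.inr q := rfl

theorem mm_mul (p p' : MvPolynomial α K) (q q' : MvPolynomial β K) :
    mm K α β p q * mm K α β p' q' = mm K α β (p * p') (q * q') := by
  simp only [mm_apply, map_mul]; ring

theorem tensorEquivSum_tmul (p : MvPolynomial α K) (q : MvPolynomial β K) :
    tensorEquivSum K α β K (p ⊗ₜ q) = mm K α β p q := by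
  have h1 : ((tensorEquivSum K α β K).toAlgHom.comp Algebra.TensorProduct.includeLeft) =
      rename (R := K) (Sum.inl : α → α ⊕ β) := by
    ext i; simp
  have h2 : ((tensorEquivSum K α β K).toAlgHom.comp Algebra.TensorProduct.includeRight) =
      rename (R := K) (Sum.inr : β → α ⊕ β) := by
    ext i; simp
  have h3 : p ⊗ₜ[K] q = (p ⊗ₜ 1) * (1 ⊗ₜ q) := by simp
  rw [h3, map_mul, mm_apply, ← h1, ← h2]
  rfl

theorem monomial_eq_mm (u : α ⊕ β →₀ ℕ) :
    (monomial u (1 : K) : MvPolynomial (α ⊕ β) K) =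
      mm K α β (monomial (Finsupp.sumFinsuppEquivProdFinsupp u).1 1)
        (monomial (Finsupp.sumFinsuppEquivProdFinsupp u).2 1) := by
  classical
  rw [mm_apply, rename_monomial, rename_monomial, monomial_mul, one_mul]
  refine congrArg (fun v => (monomial v (1 : K) : MvPolynomial (α ⊕ β) K)) ?_
  refine Finsupp.ext fun s => ?_
  rcases s with s | s
  · rw [Finsupp.add_apply, Finsupp.mapDomain_apply Sum.inl_injective,
      Finsupp.mapDomain_notin_range _ _ (by simp)]
    simp
  · rw [Finsupp.add_apply, Finsupp.mapDomain_apply Sum.inr_injective,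
      Finsupp.mapDomain_notin_range _ _ (by simp)]
    simp

theorem supp_disjSum (u : α ⊕ β →₀ ℕ) (A : Finset α) (B : Finset β) :
    (↑u.support : Set (α ⊕ β)) ⊆ ↑(A.disjSum B) ↔
    (↑(Finsupp.sumFinsuppEquivProdFinsupp u).1.support : Set α) ⊆ ↑A ∧
    (↑(Finsupp.sumFinsuppEquivProdFinsupp u).2.support : Set β) ⊆ ↑B := by
  simp only [Set.subset_def, Finset.mem_coe, Finsupp.mem_support_iff, Sum.forall,
    Finset.inl_mem_disjSum, Finset.inr_mem_disjSum, Finsupp.fst_sumFinsuppEquivProdFinsupp,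
    Finsupp.snd_sumFinsuppEquivProdFinsupp]

variable [Fintype β] {ι₁ ιq ι₂ : Type} (A₁ : ι₁ → Finset α) (Aq : ιq → Finset α)
  (B₂ : ι₂ → Finset β)

/-- The variable sets of the combined decomposition. -/
def cA : ι₁ ⊕ (ιq × ι₂) → Finset (α ⊕ β)
  | Sum.inl i => (A₁ i).disjSum Finset.univ
  | Sum.inr p => (Aq p.1).disjSum (B₂ p.2)

/-- Splitting of the index set of the combined decomposition. -/
noncomputable def splitIdx : SIdx (cA α β A₁ Aq B₂) →
    (SIdx A₁ × (β →₀ ℕ)) ⊕ (SIdx Aq × SIdx B₂)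
  | ⟨Sum.inl i, u⟩ => Sum.inl (⟨i, ⟨_, ((supp_disjSum α β u.1 _ _).1 u.2).1⟩⟩,
      (Finsupp.sumFinsuppEquivProdFinsupp u.1).2)
  | ⟨Sum.inr (i, j), u⟩ => Sum.inr (⟨i, ⟨_, ((supp_disjSum α β u.1 _ _).1 u.2).1⟩⟩,
      ⟨j, ⟨_, ((supp_disjSum α β u.1 _ _).1 u.2).2⟩⟩)

theorem splitIdx_bij : Function.Bijective (splitIdx α β A₁ Aq B₂) := by
  constructor
  · rintro ⟨i | ⟨i, j⟩, ⟨u, hu⟩⟩ ⟨i' | ⟨i', j'⟩, ⟨u', hu'⟩⟩ h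
    · simp only [splitIdx, Sum.inl.injEq, Prod.mk.injEq, Sigma.mk.injEq] at h
      obtain ⟨⟨rfl, h1⟩, h2⟩ := h
      have h1 := Subtype.ext_iff.1 (eq_of_heq h1)
      have : u = u' := Finsupp.sumFinsuppEquivProdFinsupp.injective (Prod.ext h1 h2)
      subst this; rfl
    · simp [splitIdx] at h
    · simp [splitIdx] at h
    · simp only [splitIdx, Sum.inr.injEq, Prod.mk.injEq, Sigma.mk.injEq] at h
      obtain ⟨⟨rfl, h1⟩, ⟨rfl, h2⟩⟩ := h
      have h1 := Subtype.ext_iff.1 (eq_of_heq h1)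
      have h2 := Subtype.ext_iff.1 (eq_of_heq h2)
      have : u = u' := Finsupp.sumFinsuppEquivProdFinsupp.injective (Prod.ext h1 h2)
      subst this; rfl
  · rintro (⟨⟨i, u, hu⟩, v⟩ | ⟨⟨i, u, hu⟩, ⟨j, v, hv⟩⟩)
    · refine ⟨⟨Sum.inl i, ⟨Finsupp.sumFinsuppEquivProdFinsupp.symm (u, v), ?_⟩⟩, ?_⟩
      · refine (supp_disjSum α β _ _ _).2 ?_
        rw [Equiv.apply_symm_apply]; exact ⟨hu, by simp⟩
      · simp [splitIdx]
    · refine ⟨⟨Sum.inr (i, j), ⟨Finsupp.sumFinsuppEquivProdFinsupp.symm (u, v), ?_⟩⟩, ?_⟩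
      · refine (supp_disjSum α β _ _ _).2 ?_
        rw [Equiv.apply_symm_apply]; exact ⟨hu, hv⟩
      · simp [splitIdx]

variable (I₁ : Ideal (MvPolynomial α K)) (I₂ : Ideal (MvPolynomial β K))

/-- The sum ideal. -/
noncomputable abbrev sumI : Ideal (MvPolynomial (α ⊕ β) K) :=
  Ideal.map (rename (Sum.inl : α → α ⊕ β)) I₁ ⊔ Ideal.map (rename (Sum.inr : β → α ⊕ β)) I₂

theorem mm_mem_left {p : MvPolynomial α K} (hp : p ∈ I₁) (q : MvPolynomial β K) :
    mm K α β p q ∈ sumI K α β I₁ I₂ := by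
  rw [mm_apply]
  exact Ideal.mul_mem_right _ _ (Ideal.mem_sup_left (Ideal.mem_map_of_mem _ hp))

theorem mm_mem_right (p : MvPolynomial α K) {q : MvPolynomial β K} (hq : q ∈ I₂) :
    mm K α β p q ∈ sumI K α β I₁ I₂ := by
  rw [mm_apply]
  exact Ideal.mul_mem_left _ _ (Ideal.mem_sup_right (Ideal.mem_map_of_mem _ hq))

theorem sumI_le (S : Submodule K (MvPolynomial (α ⊕ β) K))
    (h1 : ∀ p ∈ I₁, ∀ q, mm K α β p q ∈ S) (h2 : ∀ p, ∀ q ∈ I₂, mm K α β p q ∈ S)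
    (x : MvPolynomial (α ⊕ β) K) (hx : x ∈ sumI K α β I₁ I₂) : x ∈ S := by
  have hr : ∀ y : MvPolynomial (α ⊕ β) K, (∀ a b, mm K α β a b * y ∈ S) → ∀ r, r * y ∈ S := by
    intro y hy r
    obtain ⟨t, rfl⟩ := (tensorEquivSum K α β K).surjective r
    induction t using TensorProduct.induction_on with
    | zero => simp
    | tmul a b => rw [tensorEquivSum_tmul]; exact hy a b
    | add s t hs ht => rw [map_add, add_mul]; exact S.add_mem hs ht
  have key : ∀ x ∈ sumI K α β I₁ I₂, ∀ r, r * x ∈ S := by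
    intro x hx
    obtain ⟨x1, hx1, x2, hx2, rfl⟩ := Submodule.mem_sup.1 hx
    have k1 : ∀ r, r * x1 ∈ S := by
      refine Submodule.span_induction (p := fun x _ => ∀ r, r * x ∈ S) ?_ ?_ ?_ ?_ hx1
      · rintro _ ⟨p, hp, rfl⟩
        refine hr _ fun a b => ?_
        have : (rename (Sum.inl : α → α ⊕ β) p : MvPolynomial (α ⊕ β) K) = mm K α β p 1 := by
          simp [mm_apply]
        change _ * (rename (Sum.inl : α → α ⊕ β) p : MvPolynomial (α ⊕ β) K) ∈ S
        rw [this, mm_mul]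
        exact h1 _ (I₁.mul_mem_left _ hp) _
      · simp
      · intro a b _ _ ha hb r; rw [mul_add]; exact S.add_mem (ha r) (hb r)
      · intro a b _ hb r; rw [smul_eq_mul, ← mul_assoc]; exact hb _
    have k2 : ∀ r, r * x2 ∈ S := by
      refine Submodule.span_induction (p := fun x _ => ∀ r, r * x ∈ S) ?_ ?_ ?_ ?_ hx2
      · rintro _ ⟨p, hp, rfl⟩
        refine hr _ fun a b => ?_
        have : (rename (Sum.inr : β → α ⊕ β) p : MvPolynomial (α ⊕ β) K) = mm K α β 1 p := by
          simp [mm_apply]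
        change _ * (rename (Sum.inr : β → α ⊕ β) p : MvPolynomial (α ⊕ β) K) ∈ S
        rw [this, mm_mul]
        exact h2 _ _ (I₂.mul_mem_left _ hp)
      · simp
      · intro a b _ _ ha hb r; rw [mul_add]; exact S.add_mem (ha r) (hb r)
      · intro a b _ hb r; rw [smul_eq_mul, ← mul_assoc]; exact hb _
    intro r
    rw [mul_add]; exact S.add_mem (k1 r) (k2 r)
  simpa using key x hx 1

/-- The generators of the combined decomposition. -/
noncomputable def cW (w₁ : ι₁ → I₁) (c : ιq → MvPolynomial α K) (w₂ : ι₂ → I₂) :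
    ι₁ ⊕ (ιq × ι₂) → sumI K α β I₁ I₂
  | Sum.inl i => ⟨mm K α β (w₁ i) 1, mm_mem_left K α β I₁ I₂ (w₁ i).2 1⟩
  | Sum.inr p => ⟨mm K α β (c p.1) (w₂ p.2), mm_mem_right K α β I₁ I₂ (c p.1) (w₂ p.2).2⟩

theorem sbasis_prod (w₁ : ι₁ → I₁) (wq : ιq → MvPolynomial α K ⧸ I₁) (w₂ : ι₂ → I₂)
    (c : ιq → MvPolynomial α K) (hc : ∀ i, Ideal.Quotient.mk I₁ (c i) = wq i)
    (h₁ : SBasis K α I₁ w₁ A₁) (hq : SBasis K α (MvPolynomial α K ⧸ I₁) wq Aq)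
    (h₂ : SBasis K β I₂ w₂ B₂) :
    SBasis K (α ⊕ β) (sumI K α β I₁ I₂) (cW K α β I₁ I₂ w₁ c w₂) (cA α β A₁ Aq B₂) := by
  let i₁ : I₁ →ₗ[K] MvPolynomial α K := I₁.subtype.restrictScalars K
  let i₂ : I₂ →ₗ[K] MvPolynomial β K := I₂.subtype.restrictScalars K
  let iJ : sumI K α β I₁ I₂ →ₗ[K] MvPolynomial (α ⊕ β) K :=
    (sumI K α β I₁ I₂).subtype.restrictScalars K
  let φ : MvPolynomial α K →ₗ[K] MvPolynomial α K ⧸ I₁ := (Ideal.Quotient.mkₐ K I₁).toLinearMap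
  let f₁ : SIdx A₁ → MvPolynomial α K := i₁ ∘ sFam K α I₁ w₁ A₁
  let f₂ : SIdx B₂ → MvPolynomial β K := i₂ ∘ sFam K β I₂ w₂ B₂
  let fc : SIdx Aq → MvPolynomial α K := sFam K α (MvPolynomial α K) c Aq
  have hφc : φ ∘ fc = sFam K α (MvPolynomial α K ⧸ I₁) wq Aq := by
    funext p
    simp only [sFam, ← hc, fc, Function.comp]
    rfl
  have hinj₁ : Function.Injective i₁ := Subtype.val_injective
  have hinj₂ : Function.Injective i₂ := Subtype.val_injective
  have hinjJ : Function.Injective iJ := Subtype.val_injective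
  have lf₁ : LinearIndependent K f₁ := h₁.1.map' i₁ (LinearMap.ker_eq_bot.2 hinj₁)
  have lf₂ : LinearIndependent K f₂ := h₂.1.map' i₂ (LinearMap.ker_eq_bot.2 hinj₂)
  have lm := (basisMonomials β K).linearIndependent
  let F : (SIdx A₁ × (β →₀ ℕ)) ⊕ (SIdx Aq × SIdx B₂) → MvPolynomial (α ⊕ β) K :=
    Sum.elim (fun p => mm K α β (f₁ p.1) (basisMonomials β K p.2))
      (fun p => mm K α β (fc p.1) (f₂ p.2))
  have hF : iJ ∘ sFam K (α ⊕ β) (sumI K α β I₁ I₂) (cW K α β I₁ I₂ w₁ c w₂)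
      (cA α β A₁ Aq B₂) = F ∘ splitIdx α β A₁ Aq B₂ := by
    funext p
    rcases p with ⟨i | ⟨i, j⟩, u⟩
    · change monomial u.1 (1 : K) * mm K α β (w₁ i) 1 = _
      rw [monomial_eq_mm, mm_mul, mul_one]
      simp [F, splitIdx, f₁, sFam, i₁]
    · change monomial u.1 (1 : K) * mm K α β (c i) (w₂ j) = _
      rw [monomial_eq_mm, mm_mul]
      simp [F, splitIdx, f₂, fc, sFam, i₂]
  have lF : LinearIndependent K F := by
    have hFT : F = (tensorEquivSum K α β K).toLinearEquiv.toLinearMap ∘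
        Sum.elim (fun p : SIdx A₁ × (β →₀ ℕ) => f₁ p.1 ⊗ₜ[K] (basisMonomials β K p.2))
          (fun p : SIdx Aq × SIdx B₂ => fc p.1 ⊗ₜ[K] f₂ p.2) := by
      funext p
      rcases p with p | p
      · exact (tensorEquivSum_tmul K α β _ _).symm
      · exact (tensorEquivSum_tmul K α β _ _).symm
    rw [hFT]
    refine LinearIndependent.map' ?_ _ (LinearEquiv.ker _)
    refine li_sumElim_of_map (LinearMap.rTensor (MvPolynomial β K) φ)
      (lf₁.tmul_of_isDomain lm) ?_ ?_
    · intro p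
      have : φ (f₁ p.1) = 0 := Ideal.Quotient.eq_zero_iff_mem.2 (sFam K α I₁ w₁ A₁ p.1).2
      rw [LinearMap.rTensor_tmul, this, TensorProduct.zero_tmul]
    · have := hq.1.tmul_of_isDomain lf₂
      rw [← hφc] at this
      exact this
  have hb := splitIdx_bij α β A₁ Aq B₂
  refine ⟨?_, ?_⟩
  · refine LinearIndependent.of_comp iJ ?_
    rw [hF]
    exact lF.comp _ hb.1
  · refine span_top_of_inj iJ hinjJ _ ?_
    rw [hF, hb.2.range_comp]
    have m₁ : ∀ p ∈ I₁, p ∈ Submodule.span K (Set.range f₁) := by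
      intro p hp
      have : (⟨p, hp⟩ : I₁) ∈ Submodule.span K (Set.range (sFam K α I₁ w₁ A₁)) := by
        rw [h₁.2]; trivial
      have := Submodule.mem_map_of_mem (f := i₁) this
      rwa [Submodule.map_span, ← Set.range_comp] at this
    have m₂ : ∀ p ∈ I₂, p ∈ Submodule.span K (Set.range f₂) := by
      intro p hp
      have : (⟨p, hp⟩ : I₂) ∈ Submodule.span K (Set.range (sFam K β I₂ w₂ B₂)) := by
        rw [h₂.2]; trivial
      have := Submodule.mem_map_of_mem (f := i₂) this
      rwa [Submodule.map_span, ← Set.range_comp] at this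
    have g1 : ∀ p ∈ I₁, ∀ q, mm K α β p q ∈ Submodule.span K (Set.range F) := by
      intro p hp q
      refine bil_mem (mm K α β) f₁ (basisMonomials β K) _ ?_ (m₁ p hp) ?_
      · intro i j
        exact Submodule.subset_span ⟨Sum.inl (i, j), rfl⟩
      · rw [(basisMonomials β K).span_eq]; trivial
    have g2 : ∀ p, ∀ q ∈ I₂, mm K α β p q ∈ Submodule.span K (Set.range F) := by
      intro p q hq2
      have hp : φ p ∈ Submodule.span K (Set.range (φ ∘ fc)) := by
        rw [hφc, hq.2]; trivial
      rw [Set.range_comp, Submodule.span_image] at hp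
      obtain ⟨p', hp', hpp⟩ := hp
      have hd : p - p' ∈ I₁ := by
        rw [← Ideal.Quotient.eq_zero_iff_mem]
        change φ (p - p') = 0
        rw [map_sub, hpp, sub_self]
      have : mm K α β p q = mm K α β (p - p') q + mm K α β p' q := by
        rw [map_sub, LinearMap.sub_apply, sub_add_cancel]
      rw [this]
      refine Submodule.add_mem _ (g1 _ hd q) ?_
      refine bil_mem (mm K α β) fc f₂ _ ?_ hp' (m₂ q hq2)
      intro i j
      exact Submodule.subset_span ⟨Sum.inr (i, j), rfl⟩
    rintro ⟨x, hx⟩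
    exact sumI_le K α β I₁ I₂ _ g1 g2 x hx

end Prod

/-- Let `A` and `B` be two disjoint finite sets of variables (modelled by the two summands
of `α ⊕ β`), and `I₁ ⊂ K[A]`, `I₂ ⊂ K[B]` squarefree monomial ideals with
`sdepth(I₁) > sdepth(K[A]/I₁)`. Then
`sdepth_{K[A∪B]}((I₁ + I₂)K[A∪B]) ≥ sdepth(K[A]/I₁) + sdepth(I₂)`. -/
theorem sdepth_sum_ideal_ge (K : Type) [Field K] (α β : Type) [Fintype α] [Fintype β]
    (I₁ : Ideal (MvPolynomial α K)) (I₂ : Ideal (MvPolynomial β K))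
    (hI₁ : IsSquarefreeMonomialIdeal I₁) (hI₂ : IsSquarefreeMonomialIdeal I₂)
    (h : sdepth K α I₁ > sdepth K α (MvPolynomial α K ⧸ I₁)) :
    sdepth K (α ⊕ β)
        (↥(Ideal.map (rename (Sum.inl : α → α ⊕ β)) I₁ ⊔
            Ideal.map (rename (Sum.inr : β → α ⊕ β)) I₂)) ≥
      sdepth K α (MvPolynomial α K ⧸ I₁) + sdepth K β I₂ := by
  obtain ⟨ι₁, _, w₁', A₁', hb₁'⟩ := exists_sbasis_ideal hI₁
  obtain ⟨ιq, _, wq', Aq', hbq'⟩ := exists_sbasis_quot hI₁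
  obtain ⟨ι₂, _, w₂', A₂', hb₂'⟩ := exists_sbasis_ideal hI₂
  obtain ⟨r₁, w₁, A₁, hb₁, hd₁, hr₁⟩ := sdepth_attained K α I₁ w₁' A₁' hb₁'
  obtain ⟨rq, wq, Aq, hbq, hdq, _⟩ := sdepth_attained K α (MvPolynomial α K ⧸ I₁) wq' Aq' hbq'
  obtain ⟨r₂, w₂, B₂, hb₂, hd₂, _⟩ := sdepth_attained K β I₂ w₂' A₂' hb₂'
  choose c hc using fun i => Ideal.Quotient.mk_surjective (wq i)
  have hb := sbasis_prod K α β A₁ Aq B₂ I₁ I₂ w₁ wq w₂ c hc hb₁ hbq hb₂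
  have : Nonempty (Fin r₁ ⊕ (Fin rq × Fin r₂)) := ⟨Sum.inl ⟨0, hr₁ (by omega)⟩⟩
  refine le_sdepth K (α ⊕ β) _ _ _ hb _ ?_
  rintro (i | ⟨i, j⟩)
  · have h1 := hd₁ i
    have h2 := sdepth_le_card K β I₂
    simp only [cA, Finset.card_disjSum, Finset.card_univ]
    omega
  · have h1 := hdq i
    have h2 := hd₂ j
    simp only [cA, Finset.card_disjSum]
    omega
end

section
/- For every integer n ≥ 1, sdepth_{S_{n,2}}(I(P_{n,2})) > sdepth(S_{n,2}/I(P_{n,2})) = ⌈n/3⌉. -/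
open MvPolynomial

/-- `F` can be partitioned into intervals with tops of size at least `d`. -/
def IPart {V : Type} [DecidableEq V] (d : ℕ) (F : Set (Finset V)) : Prop :=
  ∃ P : Finset (Finset V × Finset V),
    (∀ p ∈ P, p.1 ⊆ p.2 ∧ d ≤ p.2.card ∧ ∀ T, p.1 ⊆ T → T ⊆ p.2 → T ∈ F) ∧
    (∀ T ∈ F, ∃ p ∈ P, p.1 ⊆ T ∧ T ⊆ p.2) ∧
    (∀ p ∈ P, ∀ q ∈ P, ∀ T, p.1 ⊆ T → T ⊆ p.2 → q.1 ⊆ T → T ⊆ q.2 → p = q)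

section PartLemmas
variable {V : Type} [DecidableEq V]

lemma IPart.mono {d d' : ℕ} {F : Set (Finset V)} (h : IPart d F) (hd : d' ≤ d) : IPart d' F := by
  obtain ⟨P, h1, h2, h3⟩ := h
  exact ⟨P, fun p hp => ⟨(h1 p hp).1, hd.trans (h1 p hp).2.1, (h1 p hp).2.2⟩, h2, h3⟩

lemma IPart.union {d : ℕ} {F G : Set (Finset V)} (hF : IPart d F) (hG : IPart d G)
    (hd : ∀ T, T ∈ F → T ∉ G) : IPart d (F ∪ G) := by
  obtain ⟨P, h1, h2, h3⟩ := hF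
  obtain ⟨Q, k1, k2, k3⟩ := hG
  refine ⟨P ∪ Q, ?_, ?_, ?_⟩
  · intro p hp
    rcases Finset.mem_union.1 hp with hp | hp
    · exact ⟨(h1 p hp).1, (h1 p hp).2.1, fun T a b => Or.inl ((h1 p hp).2.2 T a b)⟩
    · exact ⟨(k1 p hp).1, (k1 p hp).2.1, fun T a b => Or.inr ((k1 p hp).2.2 T a b)⟩
  · rintro T (hT | hT)
    · obtain ⟨p, hp, h⟩ := h2 T hT
      exact ⟨p, Finset.mem_union_left _ hp, h⟩
    · obtain ⟨p, hp, h⟩ := k2 T hT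
      exact ⟨p, Finset.mem_union_right _ hp, h⟩
  · intro p hp q hq T a b c e
    rcases Finset.mem_union.1 hp with hp | hp <;> rcases Finset.mem_union.1 hq with hq | hq
    · exact h3 p hp q hq T a b c e
    · exact absurd ((k1 q hq).2.2 T c e) (hd T ((h1 p hp).2.2 T a b))
    · exact absurd ((k1 p hp).2.2 T a b) (hd T ((h1 q hq).2.2 T c e))
    · exact k3 p hp q hq T a b c e

lemma IPart.join {d : ℕ} {F : Set (Finset V)} (hF : IPart d F) (C D : Finset V) (hCD : C ⊆ D)
    (hdis : ∀ T ∈ F, Disjoint T D) : IPart (d + D.card) {T | T \ D ∈ F ∧ C ⊆ T} := by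
  obtain ⟨P, h1, h2, h3⟩ := hF
  have key : ∀ p ∈ P, Disjoint p.1 D ∧ Disjoint p.2 D := fun p hp =>
    ⟨hdis _ ((h1 p hp).2.2 _ (Finset.Subset.refl _) (h1 p hp).1),
     hdis _ ((h1 p hp).2.2 _ (h1 p hp).1 (Finset.Subset.refl _))⟩
  have key2 : ∀ p ∈ P, ∀ T, p.1 ∪ C ⊆ T → T ⊆ p.2 ∪ D → p.1 ⊆ T \ D ∧ T \ D ⊆ p.2 := by
    intro p hp T a b
    obtain ⟨e1, e2⟩ := key p hp
    rw [Finset.disjoint_left] at e1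
    constructor
    · intro x hx
      exact Finset.mem_sdiff.2 ⟨a (Finset.mem_union_left _ hx), e1 hx⟩
    · intro x hx
      obtain ⟨hx, hx'⟩ := Finset.mem_sdiff.1 hx
      rcases Finset.mem_union.1 (b hx) with h | h
      · exact h
      · exact absurd h hx'
  refine ⟨P.image (fun p => (p.1 ∪ C, p.2 ∪ D)), ?_, ?_, ?_⟩
  · intro p hp
    obtain ⟨p, hp', rfl⟩ := Finset.mem_image.1 hp
    clear hp
    rename' hp' => hp
    refine ⟨Finset.union_subset_union (h1 p hp).1 hCD, ?_, ?_⟩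
    · rw [Finset.card_union_of_disjoint (key p hp).2]
      have := (h1 p hp).2.1
      omega
    · intro T a b
      refine ⟨(h1 p hp).2.2 _ (key2 p hp T a b).1 (key2 p hp T a b).2, ?_⟩
      exact Finset.subset_union_right.trans a
  · rintro T ⟨hT, hC⟩
    obtain ⟨p, hp, a, b⟩ := h2 _ hT
    refine ⟨_, Finset.mem_image_of_mem _ hp, ?_, ?_⟩
    · exact Finset.union_subset (a.trans Finset.sdiff_subset) hC
    · intro x hx
      by_cases hxD : x ∈ D
      · exact Finset.mem_union_right _ hxD
      · exact Finset.mem_union_left _ (b (Finset.mem_sdiff.2 ⟨hx, hxD⟩))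
  · intro p hp q hq T a b c e
    obtain ⟨p, hp', rfl⟩ := Finset.mem_image.1 hp
    clear hp
    rename' hp' => hp
    obtain ⟨q, hq', rfl⟩ := Finset.mem_image.1 hq
    clear hq
    rename' hq' => hq
    have := h3 p hp q hq (T \ D) (key2 p hp T a b).1 (key2 p hp T a b).2
      (key2 q hq T c e).1 (key2 q hq T c e).2
    rw [this]

end PartLemmas

/-- Simplified adjacency. -/
lemma pAdj_iff {n : ℕ} (a b : Fin n × Fin 2) : pAdj n 2 a b ↔
    a ≠ b ∧ (a.1 : ℕ) ≤ b.1 + 1 ∧ (b.1 : ℕ) ≤ a.1 + 1 := by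
  unfold pAdj
  have h1 := a.2.2
  have h2 := b.2.2
  rw [abs_le, abs_le]
  constructor
  · rintro ⟨h, h3, h4⟩
    exact ⟨h, by omega, by omega⟩
  · rintro ⟨h, h3, h4⟩
    exact ⟨h, by omega, by omega⟩

/-- Independent sets of the first `k` columns. -/
def IndF (n k : ℕ) : Set (Finset (Fin n × Fin 2)) :=
  {T | (∀ u ∈ T, (u.1 : ℕ) < k) ∧ ∀ u ∈ T, ∀ v ∈ T, ¬ pAdj n 2 u v}

/-- Dependent sets of the first `k` columns. -/
def DepF (n k : ℕ) : Set (Finset (Fin n × Fin 2)) :=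
  {T | (∀ u ∈ T, (u.1 : ℕ) < k) ∧ ∃ u ∈ T, ∃ v ∈ T, pAdj n 2 u v}

lemma part_IndF_zero (n : ℕ) : IPart 0 (IndF n 0) := by
  refine ⟨{(∅, ∅)}, ?_, ?_, ?_⟩
  · intro p hp
    rw [Finset.mem_singleton] at hp
    subst hp
    refine ⟨by simp, by simp, ?_⟩
    intro T _ h
    have : T = ∅ := Finset.subset_empty.1 h
    subst this
    simp [IndF]
  · rintro T ⟨h, _⟩
    refine ⟨_, Finset.mem_singleton_self _, by simp, ?_⟩
    intro x hx
    exact absurd (h x hx) (by omega)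
  · intro p hp q hq _ _ _ _ _
    rw [Finset.mem_singleton] at hp hq
    rw [hp, hq]

/-- adding a vertex to an independent set -/
lemma IndF_insert {n k l : ℕ} {T : Finset (Fin n × Fin 2)} {c : Fin n × Fin 2}
    (h : T \ {c} ∈ IndF n k) (hc : k < c.1 ∨ k = 0) (hl : (c.1 : ℕ) < l) : T ∈ IndF n l := by
  obtain ⟨h1, h2⟩ := h
  have h3 : ∀ u ∈ T, u ≠ c → (u.1 : ℕ) < k := fun u hu huc =>
    h1 u (by simp [hu, huc])
  refine ⟨?_, ?_⟩
  · intro u hu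
    by_cases huc : u = c
    · rw [huc]; exact hl
    · have := h3 u hu huc; omega
  · intro u hu v hv
    by_cases huc : u = c <;> by_cases hvc : v = c
    · rw [huc, hvc, pAdj_iff]; simp
    · rw [huc, pAdj_iff]; have := h3 v hv hvc; omega
    · rw [hvc, pAdj_iff]; have := h3 u hu huc; omega
    · exact h2 u (by simp [hu, huc]) v (by simp [hv, hvc])

lemma IndF_remove {n k l : ℕ} {T D : Finset (Fin n × Fin 2)}
    (h : T ∈ IndF n l) (hk : ∀ u ∈ T, u ∉ D → (u.1 : ℕ) < k) : T \ D ∈ IndF n k := by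
  obtain ⟨h1, h2⟩ := h
  refine ⟨?_, ?_⟩
  · intro u hu
    obtain ⟨hu, hu'⟩ := Finset.mem_sdiff.1 hu
    exact hk u hu hu'
  · intro u hu v hv
    exact h2 u (Finset.mem_sdiff.1 hu).1 v (Finset.mem_sdiff.1 hv).1

lemma IndF_disj {n k : ℕ} {T D : Finset (Fin n × Fin 2)} (h : T ∈ IndF n k)
    (hD : ∀ u ∈ D, k ≤ u.1) : Disjoint T D := by
  rw [Finset.disjoint_left]
  intro u hu hu'
  have := h.1 u hu
  have := hD u hu'
  omega

lemma fin2_cases {n : ℕ} (u : Fin n × Fin 2) {k : ℕ} (hk : k < n) (h : (u.1 : ℕ) = k) :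
    u = (⟨k, hk⟩, 0) ∨ u = (⟨k, hk⟩, 1) := by
  obtain ⟨i, j⟩ := u
  have : i = ⟨k, hk⟩ := Fin.ext h
  subst this
  fin_cases j <;> simp

lemma part_IndF (n : ℕ) : ∀ k, k ≤ n → IPart ((k + 2) / 3) (IndF n k) := by
  intro k
  induction k using Nat.strong_induction_on with
  | _ k ih =>
  intro hk
  rcases Nat.eq_zero_or_pos k with rfl | hpos
  · exact part_IndF_zero n
  have hk1 : k - 1 < n := by omega
  have hk2 : k - 2 < n := by omega
  have A := ih (k - 2) (by omega) (by omega)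
  have B := ih (k - 3) (by omega) (by omega)
  have F1 := (A.join ∅ {(⟨k - 1, hk1⟩, 0)} (by simp)
    (fun T hT => IndF_disj hT (by simp; omega))).mono (d' := (k + 2) / 3) (by simp; omega)
  have F2 := (A.join {(⟨k - 1, hk1⟩, 1)} {(⟨k - 1, hk1⟩, 1)} (by simp)
    (fun T hT => IndF_disj hT (by simp; omega))).mono (d' := (k + 2) / 3) (by simp; omega)
  have F12 := F1.union F2 (by
    rintro T ⟨h, -⟩ ⟨-, h'⟩
    have h' := Finset.singleton_subset_iff.1 h'
    have := h.1 (⟨k - 1, hk1⟩, 1) (by simp [h'])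
    simp at this
    omega)
  by_cases hk3 : k = 1
  · subst hk3
    convert F12 using 1
    ext T
    constructor
    · intro hT
      by_cases hb : ((⟨0, hk1⟩, 1) : Fin n × Fin 2) ∈ T
      · right
        refine ⟨IndF_remove hT ?_, by simpa using hb⟩
        intro u hu hu'
        exfalso
        apply hT.2 u hu _ hb
        rw [pAdj_iff]
        have := hT.1 u hu
        refine ⟨by simpa using hu', ?_, ?_⟩ <;> simp <;> omega
      · left
        refine ⟨IndF_remove hT ?_, by simp⟩
        intro u hu hu'
        exfalso
        have := hT.1 u hu
        rcases fin2_cases u hk1 (by omega) with h | h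
        · exact hu' (by simp [h])
        · exact hb (h ▸ hu)
    · rintro (⟨h, -⟩ | ⟨h, -⟩)
      · exact IndF_insert h (Or.inr rfl) (by simp)
      · exact IndF_insert h (Or.inr rfl) (by simp)
  have F3 := (B.join {(⟨k - 2, hk2⟩, 0)} {(⟨k - 2, hk2⟩, 0)} (by simp)
    (fun T hT => IndF_disj hT (by simp; omega))).mono (d' := (k + 2) / 3) (by simp; omega)
  have F4 := (B.join {(⟨k - 2, hk2⟩, 1)} {(⟨k - 2, hk2⟩, 1)} (by simp)
    (fun T hT => IndF_disj hT (by simp; omega))).mono (d' := (k + 2) / 3) (by simp; omega)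
  have F34 := F3.union F4 (by
    rintro T ⟨h, -⟩ ⟨-, h'⟩
    have h' := Finset.singleton_subset_iff.1 h'
    have := h.1 (⟨k - 2, hk2⟩, 1) (by simp [h'])
    simp at this
    omega)
  have FF := F12.union F34 (by
    have hne : k - 2 ≠ k - 1 := by omega
    rintro T (⟨h, -⟩ | ⟨h, -⟩) (⟨-, h'⟩ | ⟨-, h'⟩) <;>
    · have h' := Finset.singleton_subset_iff.1 h'
      have := h.1 _ (Finset.mem_sdiff.2 ⟨h', by simp [hne]⟩)
      simp at this)
  convert FF using 1
  ext T
  constructor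
  · intro hT
    have aux : ∀ c ∈ T, ∀ u ∈ T, u ∉ ({c} : Finset _) →
        (u.1 : ℕ) + 1 < c.1 ∨ (c.1 : ℕ) + 1 < u.1 := by
      intro c hc u hu huc
      have := hT.2 u hu c hc
      rw [pAdj_iff] at this
      have huc : u ≠ c := by simpa using huc
      by_contra hcon
      exact this ⟨huc, by omega, by omega⟩
    by_cases h3 : ((⟨k - 2, hk2⟩, 0) : Fin n × Fin 2) ∈ T
    · right; left
      refine ⟨IndF_remove hT ?_, by simpa using h3⟩
      intro u hu hu'
      have h1 := aux _ h3 u hu hu'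
      have h2 := hT.1 u hu
      simp at h1
      omega
    by_cases h4 : ((⟨k - 2, hk2⟩, 1) : Fin n × Fin 2) ∈ T
    · right; right
      refine ⟨IndF_remove hT ?_, by simpa using h4⟩
      intro u hu hu'
      have h1 := aux _ h4 u hu hu'
      have h2 := hT.1 u hu
      simp at h1
      omega
    have hne : ∀ u ∈ T, (u.1 : ℕ) ≠ k - 2 := by
      intro u hu h
      rcases fin2_cases u hk2 h with h | h
      · exact h3 (h ▸ hu)
      · exact h4 (h ▸ hu)
    left
    by_cases hb : ((⟨k - 1, hk1⟩, 1) : Fin n × Fin 2) ∈ T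
    · right
      refine ⟨IndF_remove hT ?_, by simpa using hb⟩
      intro u hu hu'
      have h1 := aux _ hb u hu hu'
      have h2 := hT.1 u hu
      have h3 := hne u hu
      simp at h1
      omega
    · left
      refine ⟨IndF_remove hT ?_, by simp⟩
      intro u hu hu'
      have h2 := hT.1 u hu
      have h3 := hne u hu
      by_contra hcon
      rcases fin2_cases u hk1 (by omega) with h | h
      · exact hu' (by simp [h])
      · exact hb (h ▸ hu)
  · rintro ((⟨h, -⟩ | ⟨h, -⟩) | (⟨h, -⟩ | ⟨h, -⟩)) <;>
    exact IndF_insert h (by simp; omega) (by simp; omega)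

lemma DepF_disj {n k : ℕ} {T D : Finset (Fin n × Fin 2)} (h : T ∈ DepF n k)
    (hD : ∀ u ∈ D, k ≤ u.1) : Disjoint T D := by
  rw [Finset.disjoint_left]
  intro u hu hu'
  have := h.1 u hu
  have := hD u hu'
  omega

/-- four cases -/
lemma part_four {n k : ℕ} (hk0 : 1 ≤ k) (hk : k < n) :
    IPart ((k + 3) / 3 + 1) {T : Finset (Fin n × Fin 2) | ∃ i j : Fin 2,
      T \ {(⟨k - 1, by omega⟩, i), (⟨k, hk⟩, j)} ∈ IndF n (k - 2) ∧
      {(⟨k - 1, by omega⟩, i), (⟨k, hk⟩, j)} ⊆ T} := by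
  have hk1 : k - 1 < n := by omega
  have hne : k - 1 ≠ k := by omega
  have A := part_IndF n (k - 2) (by omega)
  have J : ∀ i j : Fin 2, IPart ((k + 3) / 3 + 1) {T : Finset (Fin n × Fin 2) |
      T \ {(⟨k - 1, hk1⟩, i), (⟨k, hk⟩, j)} ∈ IndF n (k - 2) ∧
      {(⟨k - 1, hk1⟩, i), (⟨k, hk⟩, j)} ⊆ T} := by
    intro i j
    refine (A.join _ _ (Finset.Subset.refl _)
      (fun T hT => IndF_disj hT (by simp; omega))).mono ?_
    rw [Finset.card_pair (by simp [hne])]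
    omega
  have D : ∀ i j i' j' : Fin 2, (i ≠ i' ∨ j ≠ j') → ∀ T : Finset (Fin n × Fin 2),
      T ∈ {T : Finset (Fin n × Fin 2) |
      T \ {(⟨k - 1, hk1⟩, i), (⟨k, hk⟩, j)} ∈ IndF n (k - 2) ∧
      {(⟨k - 1, hk1⟩, i), (⟨k, hk⟩, j)} ⊆ T} → T ∉ {T : Finset (Fin n × Fin 2) |
      T \ {(⟨k - 1, hk1⟩, i'), (⟨k, hk⟩, j')} ∈ IndF n (k - 2) ∧
      {(⟨k - 1, hk1⟩, i'), (⟨k, hk⟩, j')} ⊆ T} := by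
    rintro i j i' j' h T ⟨h1, -⟩ ⟨-, h2⟩
    rcases h with h | h
    · have := h1.1 (⟨k - 1, hk1⟩, i') (Finset.mem_sdiff.2
        ⟨h2 (by simp), by simp [hne, Ne.symm h]⟩)
      simp at this
      omega
    · have := h1.1 (⟨k, hk⟩, j') (Finset.mem_sdiff.2
        ⟨h2 (by simp), by simp [hne.symm, Ne.symm h]⟩)
      simp at this
      omega
  have U1 := (J 0 0).union (J 0 1) (D _ _ _ _ (by simp))
  have U2 := (J 1 0).union (J 1 1) (D _ _ _ _ (by simp))
  have U := U1.union U2 (by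
    rintro T (h | h) (h' | h') <;> exact D _ _ _ _ (by simp) T h h')
  convert U using 1
  ext T
  constructor
  · rintro ⟨i, j, h⟩
    fin_cases i <;> fin_cases j
    · exact Or.inl (Or.inl h)
    · exact Or.inl (Or.inr h)
    · exact Or.inr (Or.inl h)
    · exact Or.inr (Or.inr h)
  · rintro ((h | h) | (h | h))
    · exact ⟨_, _, h⟩
    · exact ⟨_, _, h⟩
    · exact ⟨_, _, h⟩
    · exact ⟨_, _, h⟩

lemma part_DepF (n : ℕ) : ∀ k, k ≤ n → IPart ((k + 2) / 3 + 1) (DepF n k) := by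
  intro k
  induction k with
  | zero =>
    intro _
    refine ⟨∅, by simp, ?_, by simp⟩
    rintro T ⟨h, u, hu, -⟩
    exact absurd (h u hu) (by simp)
  | succ k ih =>
  intro hk
  have hk : k < n := hk
  have hcard : ({(⟨k, hk⟩, 0), (⟨k, hk⟩, 1)} : Finset (Fin n × Fin 2)).card = 2 :=
    Finset.card_pair (by simp)
  have hmem : ∀ u : Fin n × Fin 2, u ∈ ({(⟨k, hk⟩, 0), (⟨k, hk⟩, 1)} : Finset (Fin n × Fin 2)) ↔
      (u.1 : ℕ) = k := by
    intro u
    constructor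
    · intro h
      simp only [Finset.mem_insert, Finset.mem_singleton] at h
      rcases h with rfl | rfl <;> rfl
    · intro h
      simpa using fin2_cases u hk h
  have F1 := ((ih (by omega)).join ∅ {(⟨k, hk⟩, 0), (⟨k, hk⟩, 1)} (by simp)
    (fun T hT => DepF_disj hT (by simp))).mono (d' := (k + 3) / 3 + 1) (by omega)
  have F2 := ((part_IndF n k (by omega)).join _ {(⟨k, hk⟩, 0), (⟨k, hk⟩, 1)}
    (Finset.Subset.refl _)
    (fun T hT => IndF_disj hT (by simp))).mono (d' := (k + 3) / 3 + 1) (by omega)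
  have F12 := F1.union F2 (by
    rintro T ⟨⟨-, u, hu, v, hv, huv⟩, -⟩ ⟨h, -⟩
    exact h.2 u hu v hv huv)
  -- elements of `T` outside the last column
  have low : ∀ T : Finset (Fin n × Fin 2), (∀ u ∈ T, (u.1 : ℕ) < k + 1) →
      ∀ u ∈ T \ {(⟨k, hk⟩, 0), (⟨k, hk⟩, 1)}, (u.1 : ℕ) < k := by
    intro T hT u hu
    obtain ⟨h1, h2⟩ := Finset.mem_sdiff.1 hu
    rw [hmem] at h2
    have := hT u h1
    omega
  have up : ∀ T : Finset (Fin n × Fin 2),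
      (∀ u ∈ T \ {(⟨k, hk⟩, 0), (⟨k, hk⟩, 1)}, (u.1 : ℕ) < k) →
      (∀ u ∈ T, (u.1 : ℕ) < k + 1) := by
    intro T hT u hu
    by_cases h : (u.1 : ℕ) = k
    · omega
    · have := hT u (Finset.mem_sdiff.2 ⟨hu, by rwa [hmem]⟩)
      omega
  have hF12 : ∀ T, T ∈ ({T | T \ {(⟨k, hk⟩, 0), (⟨k, hk⟩, 1)} ∈ DepF n k ∧ ∅ ⊆ T} ∪
      {T | T \ {(⟨k, hk⟩, 0), (⟨k, hk⟩, 1)} ∈ IndF n k ∧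
        {(⟨k, hk⟩, 0), (⟨k, hk⟩, 1)} ⊆ T} : Set (Finset (Fin n × Fin 2))) →
      T ∈ DepF n (k + 1) := by
    rintro T (⟨⟨h1, u, hu, v, hv, huv⟩, -⟩ | ⟨h, h'⟩)
    · exact ⟨up T h1, u, (Finset.mem_sdiff.1 hu).1, v, (Finset.mem_sdiff.1 hv).1, huv⟩
    · refine ⟨up T h.1, (⟨k, hk⟩, 0), h' (by simp), (⟨k, hk⟩, 1), h' (by simp), ?_⟩
      rw [pAdj_iff]
      simp
  rcases Nat.eq_zero_or_pos k with hk0 | hpos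
  · convert F12 using 1
    ext T
    refine ⟨?_, hF12 T⟩
    rintro ⟨h1, u, hu, v, hv, huv⟩
    right
    have hu1 := h1 u hu
    have hv1 := h1 v hv
    refine ⟨⟨low T h1, ?_⟩, ?_⟩
    · intro u hu
      have := low T h1 u hu
      omega
    · have hne := ((pAdj_iff _ _).1 huv).1
      rcases fin2_cases u hk (by omega) with rfl | rfl <;>
      rcases fin2_cases v hk (by omega) with rfl | rfl
      · exact absurd rfl hne
      · intro x hx
        simp only [Finset.mem_insert, Finset.mem_singleton] at hx
        rcases hx with rfl | rfl <;> assumption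
      · intro x hx
        simp only [Finset.mem_insert, Finset.mem_singleton] at hx
        rcases hx with rfl | rfl <;> assumption
      · exact absurd rfl hne
  have hk1 : k - 1 < n := by omega
  have F3 := part_four hpos hk
  have small : ∀ (T : Finset (Fin n × Fin 2)) (i j : Fin 2),
      T \ {(⟨k - 1, hk1⟩, i), (⟨k, hk⟩, j)} ∈ IndF n (k - 2) →
      ∀ u ∈ T, u = (⟨k - 1, hk1⟩, i) ∨ u = (⟨k, hk⟩, j) ∨ (u.1 : ℕ) < k - 2 := by
    intro T i j h u hu
    by_contra! hcon
    have := h.1 u (Finset.mem_sdiff.2 ⟨hu, by simp [hcon.1, hcon.2.1]⟩)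
    omega
  have FF := F12.union F3 (by
    rintro T h ⟨i, j, h1, h2⟩
    have hsm := small T i j h1
    rcases h with ⟨⟨h3, u, hu, v, hv, huv⟩, -⟩ | ⟨h3, h4⟩
    · have hu' := h3 u hu
      have hv' := h3 v hv
      have huT := (Finset.mem_sdiff.1 hu).1
      have hvT := (Finset.mem_sdiff.1 hv).1
      have hadj := (pAdj_iff _ _).1 huv
      rcases hsm u huT with rfl | rfl | hu2
      · rcases hsm v hvT with rfl | rfl | hv2
        · exact hadj.1 rfl
        · simp at hv'
        · simp at hadj; omega
      · simp at hu'
      · rcases hsm v hvT with rfl | rfl | hv2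
        · simp at hadj; omega
        · simp at hv'
        · refine h1.2 u (Finset.mem_sdiff.2 ⟨huT, ?_⟩) v (Finset.mem_sdiff.2 ⟨hvT, ?_⟩) huv
          · simp only [Finset.mem_insert, Finset.mem_singleton]
            rintro (rfl | rfl) <;> simp at hu2 <;> omega
          · simp only [Finset.mem_insert, Finset.mem_singleton]
            rintro (rfl | rfl) <;> simp at hv2 <;> omega
    · have e0 := hsm (⟨k, hk⟩, 0) (h4 (by simp))
      have e1 := hsm (⟨k, hk⟩, 1) (h4 (by simp))
      have hne : k ≠ k - 1 := by omega
      simp [hne] at e0 e1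
      rcases e0 with e0 | e0
      · rcases e1 with e1 | e1
        · rw [← e0] at e1; simp at e1
        · omega
      · omega)
  convert FF using 1
  ext T
  constructor
  · rintro ⟨h1, u, hu, v, hv, huv⟩
    by_cases hd : T \ {(⟨k, hk⟩, 0), (⟨k, hk⟩, 1)} ∈ DepF n k
    · exact Or.inl (Or.inl ⟨hd, by simp⟩)
    have hind : T \ {(⟨k, hk⟩, 0), (⟨k, hk⟩, 1)} ∈ IndF n k := by
      refine ⟨low T h1, fun x hx y hy hxy => hd ⟨low T h1, x, hx, y, hy, hxy⟩⟩
    by_cases hs : {(⟨k, hk⟩, 0), (⟨k, hk⟩, 1)} ⊆ T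
    · exact Or.inl (Or.inr ⟨hind, hs⟩)
    right
    -- uniqueness in the last column
    have huniq : ∀ x ∈ T, ∀ y ∈ T, (x.1 : ℕ) = k → (y.1 : ℕ) = k → x = y := by
      intro x hx y hy hxk hyk
      by_contra hne
      apply hs
      rcases fin2_cases x hk hxk with rfl | rfl <;>
      rcases fin2_cases y hk hyk with rfl | rfl
      · exact absurd rfl hne
      · intro z hz
        simp only [Finset.mem_insert, Finset.mem_singleton] at hz
        rcases hz with rfl | rfl <;> assumption
      · intro z hz
        simp only [Finset.mem_insert, Finset.mem_singleton] at hz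
        rcases hz with rfl | rfl <;> assumption
      · exact absurd rfl hne
    have hlowind : ∀ x ∈ T, ∀ y ∈ T, (x.1 : ℕ) ≠ k → (y.1 : ℕ) ≠ k → ¬ pAdj n 2 x y := by
      intro x hx y hy hxk hyk
      exact hind.2 x (Finset.mem_sdiff.2 ⟨hx, by rwa [hmem]⟩) y
        (Finset.mem_sdiff.2 ⟨hy, by rwa [hmem]⟩)
    have main : ∃ x ∈ T, ∃ y ∈ T, (x.1 : ℕ) = k - 1 ∧ (y.1 : ℕ) = k := by
      have hadj := (pAdj_iff _ _).1 huv
      have hu1 := h1 u hu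
      have hv1 := h1 v hv
      by_cases huk : (u.1 : ℕ) = k <;> by_cases hvk : (v.1 : ℕ) = k
      · exact absurd (huniq u hu v hv huk hvk) hadj.1
      · exact ⟨v, hv, u, hu, by omega, huk⟩
      · exact ⟨u, hu, v, hv, by omega, hvk⟩
      · exact absurd huv (hlowind u hu v hv huk hvk)
    obtain ⟨x, hx, y, hy, hxk, hyk⟩ := main
    have hxe : x = (⟨k - 1, hk1⟩, x.2) := Prod.ext (Fin.ext hxk) rfl
    have hye : y = (⟨k, hk⟩, y.2) := Prod.ext (Fin.ext hyk) rfl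
    refine ⟨x.2, y.2, ?_⟩
    rw [← hxe, ← hye]
    refine ⟨⟨?_, ?_⟩, ?_⟩
    · intro z hz
      simp only [Finset.mem_sdiff, Finset.mem_insert, Finset.mem_singleton, not_or] at hz
      obtain ⟨hz, hzx, hzy⟩ := hz
      have hzk : (z.1 : ℕ) ≠ k := fun h => hzy (huniq z hz y hy h hyk)
      have h3 := hlowind z hz x hx hzk (by omega)
      rw [pAdj_iff] at h3
      have := h1 z hz
      by_contra hcon
      exact h3 ⟨hzx, by omega, by omega⟩
    · intro z hz w hw
      simp only [Finset.mem_sdiff, Finset.mem_insert, Finset.mem_singleton, not_or] at hz hw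
      obtain ⟨hz, hzx, hzy⟩ := hz
      obtain ⟨hw, hwx, hwy⟩ := hw
      exact hlowind z hz w hw (fun h => hzy (huniq z hz y hy h hyk))
        (fun h => hwy (huniq w hw y hy h hyk))
    · intro z hz
      simp only [Finset.mem_insert, Finset.mem_singleton] at hz
      rcases hz with rfl | rfl <;> assumption
  · rintro (h | ⟨i, j, h1, h2⟩)
    · exact hF12 T h
    · refine ⟨?_, (⟨k - 1, hk1⟩, i), h2 (by simp), (⟨k, hk⟩, j), h2 (by simp), ?_⟩
      · intro u hu
        rcases small T i j h1 u hu with rfl | rfl | h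
        · simp
        · simp
        · omega
      · rw [pAdj_iff]
        have hne : k - 1 ≠ k := by omega
        simp [hne]
        omega

section Alg
variable {K : Type} [Field K] {V : Type} [DecidableEq V]

/-- exponent vector of a squarefree monomial -/
noncomputable def ind (C : Finset V) : V →₀ ℕ := Finsupp.indicator C (fun _ _ => 1)

lemma ind_apply (C : Finset V) (v : V) : ind C v = if v ∈ C then 1 else 0 := by
  simp [ind, Finsupp.indicator_apply]

lemma ind_support (C : Finset V) : (ind C).support = C := by
  ext v
  simp [ind_apply]

lemma support_add' (a b : V →₀ ℕ) : (a + b).support = a.support ∪ b.support := by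
  ext v
  simp
  omega

lemma exists_decomp [Fintype V] {M : Type} [AddCommGroup M] [Module K M]
    [Module (MvPolynomial V K) M] [IsScalarTower K (MvPolynomial V K) M]
    {d : ℕ} {F : Set (Finset V)} (hF : IPart d F) (hne : F.Nonempty)
    (e : (V →₀ ℕ) → M) (φ : M →ₗ[K] MvPolynomial V K)
    (h1 : ∀ u : V →₀ ℕ, u.support ∈ F → φ (e u) = monomial u 1)
    (h2 : ∀ x : M, x ∈ Submodule.span K (e '' {u | u.support ∈ F}))
    (h3 : ∀ u : V →₀ ℕ, u.support ∈ F → ∀ v,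
      (monomial v (1 : K) : MvPolynomial V K) • e u = e (u + v)) :
    d ≤ sdepth K V M := by
  obtain ⟨P, p1, p2, p3⟩ := hF
  let ε := P.equivFin
  let pr : Fin P.card → Finset V × Finset V := fun i => (ε.symm i).1
  have hpr : ∀ i, pr i ∈ P := fun i => (ε.symm i).2
  have hprinj : Function.Injective pr := fun i j h => ε.symm.injective (Subtype.ext h)
  let w : Fin P.card → M := fun i => e (ind (pr i).1)
  let A : Fin P.card → Finset V := fun i => (pr i).2
  have hind : ∀ i, (ind (pr i).1).support ∈ F := fun i => by
    rw [ind_support]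
    exact (p1 _ (hpr i)).2.2 _ (Finset.Subset.refl _) (p1 _ (hpr i)).1
  have hind2 : ∀ i (v : V →₀ ℕ), v.support ⊆ A i → (ind (pr i).1 + v).support ∈ F := by
    intro i v hv
    rw [support_add', ind_support]
    exact (p1 _ (hpr i)).2.2 _ Finset.subset_union_left
      (Finset.union_subset (p1 _ (hpr i)).1 hv)
  let ι := {u : V →₀ ℕ // u.support ∈ F}
  let eS : ι → M := fun u => e u.1
  have hli : LinearIndependent K eS := by
    apply LinearIndependent.of_comp φ
    have : φ ∘ eS = (basisMonomials V K) ∘ (Subtype.val : ι → (V →₀ ℕ)) := by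
      funext u
      simp [eS, h1 u.1 u.2]
    rw [this]
    exact (basisMonomials V K).linearIndependent.comp _ Subtype.val_injective
  let Q : Fin P.card → Set ι := fun i => {u | (pr i).1 ⊆ u.1.support ∧ u.1.support ⊆ (pr i).2}
  have hspace : ∀ i, stanleySpace K V M (w i) (A i) = Submodule.span K (eS '' Q i) := by
    intro i
    unfold stanleySpace
    congr 1
    ext m
    constructor
    · rintro ⟨u, hu, rfl⟩
      refine ⟨⟨_, hind2 i u (by exact_mod_cast hu)⟩, ⟨?_, ?_⟩, ?_⟩
      · simp only [support_add', ind_support]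
        exact Finset.subset_union_left
      · simp only [support_add', ind_support]
        exact Finset.union_subset (p1 _ (hpr i)).1 (by exact_mod_cast hu)
      · simp only [eS, w]
        rw [h3 _ (hind i)]
    · rintro ⟨u, ⟨hu1, hu2⟩, rfl⟩
      have hle : ind (pr i).1 ≤ u.1 := by
        intro v
        rw [ind_apply]
        split_ifs with h
        · have := hu1 h
          rw [Finsupp.mem_support_iff] at this
          omega
        · simp
      refine ⟨u.1 - ind (pr i).1, ?_, ?_⟩
      · intro v hv
        apply hu2
        simp at hv ⊢
        omega
      · simp only [eS, w]
        rw [h3 _ (hind i), add_tsub_cancel_of_le hle]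
  have hdec : IsStanleyDecomp K V M w A := by
    refine ⟨?_, ?_, ?_⟩
    · intro i f hf hfw
      have e1 : f • w i = ∑ v ∈ f.support, coeff v f • e (ind (pr i).1 + v) := by
        conv_lhs => rw [f.as_sum]
        rw [Finset.sum_smul]
        refine Finset.sum_congr rfl fun v hv => ?_
        rw [← h3 _ (hind i), ← smul_assoc, smul_monomial]
        simp [w]
      have e2 : φ (f • w i) = monomial (ind (pr i).1) 1 * f := by
        rw [e1, map_sum]
        conv_rhs => rw [f.as_sum]
        rw [Finset.mul_sum]
        refine Finset.sum_congr rfl fun v hv => ?_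
        rw [map_smul, h1 _ (hind2 i v ?_), smul_monomial, monomial_mul]
        · simp
        · intro x hx
          have : x ∈ f.vars := (mem_vars_iff_mem_support x).2 ⟨v, hv, hx⟩
          exact_mod_cast hf (by exact_mod_cast this)
      rw [hfw, map_zero] at e2
      rcases mul_eq_zero.1 e2.symm with h | h
      · exact absurd h (by simp)
      · exact h
    · rw [iSupIndep_def]
      intro i
      simp only [hspace]
      have : (⨆ (j) (_ : j ≠ i), Submodule.span K (eS '' Q j)) =
          Submodule.span K (eS '' ⋃ (j) (_ : j ≠ i), Q j) := by
        simp only [Set.image_iUnion, Submodule.span_iUnion]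
      rw [this]
      apply hli.disjoint_span_image
      rw [Set.disjoint_left]
      intro u hu hu'
      simp only [Set.mem_iUnion] at hu'
      obtain ⟨j, hj, hu'⟩ := hu'
      exact hj (hprinj (p3 _ (hpr j) _ (hpr i) u.1.support hu'.1 hu'.2 hu.1 hu.2))
    · simp only [hspace]
      rw [← Submodule.span_iUnion, ← Set.image_iUnion, eq_top_iff]
      intro x _
      refine Submodule.span_mono ?_ (h2 x)
      rintro _ ⟨u, hu, rfl⟩
      refine ⟨⟨u, hu⟩, ?_, rfl⟩
      obtain ⟨p, hp, h⟩ := p2 _ hu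
      rw [Set.mem_iUnion]
      refine ⟨ε ⟨p, hp⟩, ?_⟩
      have : pr (ε ⟨p, hp⟩) = p := by simp [pr]
      simp only [Q, this]
      exact h
  unfold sdepth
  have hb : BddAbove { d | ∃ r, ∃ w : Fin r → M, ∃ A : Fin r → Finset V,
    IsStanleyDecomp K V M w A ∧ d = sInf (Set.range fun i => (A i).card) } := by
    refine ⟨Fintype.card V, ?_⟩
    rintro _ ⟨r, w, A, -, rfl⟩
    rcases Nat.eq_zero_or_pos r with rfl | hr
    · simp
    · exact (Nat.sInf_le (Set.mem_range_self (⟨0, hr⟩ : Fin r))).trans (Finset.card_le_univ _)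
  refine le_trans ?_ (le_csSup hb ⟨P.card, w, A, hdec, rfl⟩)
  obtain ⟨T, hT⟩ := hne
  obtain ⟨p, hp, -⟩ := p2 T hT
  apply le_csInf (Set.range_nonempty_iff_nonempty.2 ⟨ε ⟨p, hp⟩⟩)
  rintro _ ⟨i, rfl⟩
  exact (p1 _ (hpr i)).2.1

/-- supports of monomials in the edge ideal -/
def DepS (Adj : V → V → Prop) (T : Finset V) : Prop := ∃ a ∈ T, ∃ b ∈ T, Adj a b

lemma mem_edgeIdeal (Adj : V → V → Prop) (hA : ∀ a b, Adj a b → a ≠ b) (p : MvPolynomial V K) :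
    p ∈ edgeIdeal K Adj ↔ ∀ u ∈ p.support, DepS Adj u.support := by
  have : edgeIdeal K Adj = Ideal.span ((fun s => monomial s (1 : K)) ''
      {s | ∃ a b, Adj a b ∧ s = Finsupp.single a 1 + Finsupp.single b 1}) := by
    unfold edgeIdeal
    congr 1
    ext q
    constructor
    · rintro ⟨a, b, h, rfl⟩
      exact ⟨_, ⟨a, b, h, rfl⟩, by simp [X, monomial_mul]⟩
    · rintro ⟨_, ⟨a, b, h, rfl⟩, rfl⟩
      exact ⟨a, b, h, by simp [X, monomial_mul]⟩
  rw [this, mem_ideal_span_monomial_image]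
  refine forall₂_congr fun u _ => ?_
  constructor
  · rintro ⟨_, ⟨a, b, h, rfl⟩, hle⟩
    refine ⟨a, ?_, b, ?_, h⟩
    · have := hle a
      simp at this ⊢
      omega
    · have := hle b
      simp at this ⊢
      omega
  · rintro ⟨a, ha, b, hb, h⟩
    refine ⟨_, ⟨a, b, h, rfl⟩, ?_⟩
    have hab := hA a b h
    intro v
    simp only [Finsupp.mem_support_iff] at ha hb
    simp only [Finsupp.add_apply, Finsupp.single_apply]
    split_ifs with h1 h2 h2
    · exact absurd (h1.trans h2.symm) hab
    · subst h1; omega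
    · subst h2; omega
    · simp

lemma sdepth_ideal_ge [Fintype V] (Adj : V → V → Prop) (hA : ∀ a b, Adj a b → a ≠ b) {d : ℕ}
    (hF : IPart d {T | DepS Adj T}) (hne : ∃ T, DepS Adj T) :
    d ≤ sdepth K V (edgeIdeal K Adj) := by
  classical
  have hm : ∀ u : V →₀ ℕ, DepS Adj u.support → monomial u (1 : K) ∈ edgeIdeal K Adj := by
    intro u hu
    rw [mem_edgeIdeal Adj hA]
    intro v hv
    rw [support_monomial, if_neg one_ne_zero, Finset.mem_singleton] at hv
    rw [hv]; exact hu
  refine exists_decomp hF hne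
    (fun u => if h : DepS Adj u.support then ⟨monomial u 1, hm u h⟩ else 0)
    ((edgeIdeal K Adj).subtype.restrictScalars K) ?_ ?_ ?_
  · intro u hu
    have hu : DepS Adj u.support := hu
    simp [hu]
  · intro x
    have hx := (mem_edgeIdeal Adj hA x.1).1 x.2
    have : x = ∑ u ∈ x.1.support, coeff u x.1 •
      (if h : DepS Adj u.support then ⟨monomial u 1, hm u h⟩ else 0 : edgeIdeal K Adj) := by
      apply Subtype.ext
      rw [AddSubmonoidClass.coe_finsetSum]
      conv_lhs => rw [x.1.as_sum]
      refine Finset.sum_congr rfl fun u hu => ?_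
      rw [dif_pos (hx u hu)]
      simp [smul_monomial]
    rw [this]
    refine Submodule.sum_mem _ fun u hu => Submodule.smul_mem _ _ (Submodule.subset_span ?_)
    exact ⟨u, hx u hu, rfl⟩
  · intro u hu v
    have hu : DepS Adj u.support := hu
    have huv : DepS Adj (u + v).support := by
      obtain ⟨a, ha, b, hb, h⟩ := hu
      rw [support_add']
      exact ⟨a, Finset.mem_union_left _ ha, b, Finset.mem_union_left _ hb, h⟩
    simp only [dif_pos hu, dif_pos huv]
    apply Subtype.ext
    simp [monomial_mul, add_comm]

/-- Truncation of polynomials to the independent monomials, on the quotient. -/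
lemma exists_trunc (Adj : V → V → Prop) (hA : ∀ a b, Adj a b → a ≠ b) :
    ∃ φ : (MvPolynomial V K ⧸ edgeIdeal K Adj) →ₗ[K] MvPolynomial V K,
      ∀ u : V →₀ ℕ, ¬ DepS Adj u.support → 
        (φ (Ideal.Quotient.mk _ (monomial u 1)) = monomial u 1) ∧
        ∀ p, coeff u (φ (Ideal.Quotient.mk _ p)) = coeff u p := by
  classical
  let ρ : MvPolynomial V K →ₗ[K] MvPolynomial V K :=
    (basisMonomials V K).constr K (fun u => if DepS Adj u.support then 0 else monomial u 1)
  have hρ : ∀ u, ρ (monomial u 1) = if DepS Adj u.support then 0 else monomial u 1 := by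
    intro u
    have := (basisMonomials V K).constr_basis K
      (fun u => if DepS Adj u.support then 0 else monomial u (1 : K)) u
    simpa using this
  have hρI : (edgeIdeal K Adj).restrictScalars K ≤ LinearMap.ker ρ := by
    intro p hp
    have hp := (mem_edgeIdeal Adj hA p).1 hp
    rw [LinearMap.mem_ker, p.as_sum, map_sum]
    refine Finset.sum_eq_zero fun u hu => ?_
    have : monomial u (coeff u p) = coeff u p • monomial u (1 : K) := by simp [smul_monomial]
    rw [this, map_smul, hρ, if_pos (hp u hu), smul_zero]
  let φ := (Submodule.liftQ _ ρ hρI) ∘ₗ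
    (Submodule.Quotient.restrictScalarsEquiv K (edgeIdeal K Adj)).symm.toLinearMap
  have hφ : ∀ p, φ (Ideal.Quotient.mk _ p) = ρ p := fun p => rfl
  refine ⟨φ, fun u hu => ⟨?_, ?_⟩⟩
  · rw [hφ, hρ, if_neg hu]
  · intro p
    rw [hφ]
    have : lcoeff K u ∘ₗ ρ = lcoeff K u := by
      apply (basisMonomials V K).ext
      intro v
      simp only [coe_basisMonomials, LinearMap.comp_apply, hρ, lcoeff_apply]
      split_ifs with h
      · rw [coeff_monomial, if_neg]
        · simp
        · rintro rfl; exact hu h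
      · rfl
    exact congrArg (fun l => l p) this

lemma sdepth_quot_ge [Fintype V] (Adj : V → V → Prop) (hA : ∀ a b, Adj a b → a ≠ b) {d : ℕ}
    (hF : IPart d {T | ¬ DepS Adj T}) :
    d ≤ sdepth K V (MvPolynomial V K ⧸ edgeIdeal K Adj) := by
  classical
  obtain ⟨φ, hφ⟩ := exists_trunc (K := K) Adj hA
  refine exists_decomp hF ⟨∅, by simp [DepS]⟩
    (fun u => Ideal.Quotient.mk _ (monomial u 1)) φ (fun u hu => (hφ u hu).1) ?_ ?_
  · intro x
    obtain ⟨p, rfl⟩ := Ideal.Quotient.mk_surjective x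
    rw [p.as_sum, map_sum]
    refine Submodule.sum_mem _ fun u hu => ?_
    have : monomial u (coeff u p) = coeff u p • monomial u (1 : K) := by simp [smul_monomial]
    rw [this]
    have e : Ideal.Quotient.mk (edgeIdeal K Adj) (coeff u p • monomial u (1 : K)) =
      coeff u p • Ideal.Quotient.mk (edgeIdeal K Adj) (monomial u (1 : K)) := rfl
    rw [e]
    apply Submodule.smul_mem
    by_cases h : DepS Adj u.support
    · have : Ideal.Quotient.mk (edgeIdeal K Adj) (monomial u (1 : K)) = 0 := by
        rw [Ideal.Quotient.eq_zero_iff_mem, mem_edgeIdeal Adj hA]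
        intro v hv
        rw [support_monomial, if_neg one_ne_zero, Finset.mem_singleton] at hv
        rw [hv]; exact h
      rw [this]
      exact Submodule.zero_mem _
    · exact Submodule.subset_span ⟨u, h, rfl⟩
  · intro u hu v
    change Ideal.Quotient.mk _ (monomial v 1 * monomial u 1) = _
    rw [monomial_mul, add_comm, one_mul]

lemma sdepth_quot_le (Adj : V → V → Prop) (hA : ∀ a b, Adj a b → a ≠ b) (F : Finset V)
    (hF : ¬ DepS Adj F) (hmax : ∀ v, v ∉ F → ∃ u ∈ F, Adj v u) :
    sdepth K V (MvPolynomial V K ⧸ edgeIdeal K Adj) ≤ F.card := by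
  classical
  obtain ⟨φ, hφ⟩ := exists_trunc (K := K) Adj hA
  unfold sdepth
  apply csSup_le'
  rintro _ ⟨r, w, A, ⟨hfree, -, htop⟩, rfl⟩
  have hAi : ∀ i, F ⊆ A i → (A i).card ≤ F.card := by
    intro i hi
    apply Finset.card_le_card
    intro v hv
    by_contra hvF
    obtain ⟨u, hu, huv⟩ := hmax v hvF
    have h0 : (X v * X u : MvPolynomial V K) • w i = 0 := by
      obtain ⟨p, hp⟩ := Ideal.Quotient.mk_surjective (w i)
      rw [← hp]
      change Ideal.Quotient.mk _ ((X v * X u) * p) = 0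
      rw [Ideal.Quotient.eq_zero_iff_mem]
      exact Ideal.mul_mem_right _ _ (Ideal.subset_span ⟨v, u, huv, rfl⟩)
    have := hfree i (X v * X u) ?_ h0
    · rcases mul_eq_zero.1 this with h | h <;> exact X_ne_zero _ h
    · intro x hx
      have := vars_mul _ _ (Finset.mem_coe.1 hx)
      simp only [vars_X, Finset.mem_union, Finset.mem_singleton] at this
      rcases this with rfl | rfl
      · exact hv
      · exact hi hu
  by_cases hex : ∃ i, F ⊆ A i
  · obtain ⟨i, hi⟩ := hex
    exact (Nat.sInf_le (Set.mem_range_self i)).trans (hAi i hi)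
  exfalso
  push Not at hex
  choose q hq using fun i => Ideal.Quotient.mk_surjective (w i)
  let N := 1 + ∑ i, (q i).totalDegree
  let m : V →₀ ℕ := N • ind F
  have hmv : ∀ v ∈ F, m v = N := by
    intro v hv
    simp [m, ind_apply, hv]
  have hms : ¬ DepS Adj m.support := by
    rintro ⟨a, ha, b, hb, h⟩
    apply hF
    simp [m, ind_apply] at ha hb
    exact ⟨a, by tauto, b, by tauto, h⟩
  have hle : (⨆ i, stanleySpace K V (MvPolynomial V K ⧸ edgeIdeal K Adj) (w i) (A i)) ≤
      LinearMap.ker (lcoeff K m ∘ₗ φ) := by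
    refine iSup_le fun i => Submodule.span_le.2 ?_
    rintro _ ⟨u, hu, rfl⟩
    obtain ⟨b, hbF, hbA⟩ := Finset.not_subset.1 (hex i)
    have hub : u b = 0 := by
      by_contra h
      exact hbA (hu (by simpa using h))
    rw [SetLike.mem_coe, LinearMap.mem_ker, LinearMap.comp_apply, ← hq i]
    change coeff m (φ (Ideal.Quotient.mk _ (monomial u 1 * q i))) = 0
    rw [(hφ m hms).2, coeff_monomial_mul']
    split_ifs with h
    · rw [one_mul]
      by_contra hc
      have h1 := monomial_le_degreeOf b (mem_support_iff.2 hc)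
      have h2 := degreeOf_le_totalDegree (q i) b
      have h3 := Finset.single_le_sum (f := fun i => (q i).totalDegree)
        (fun _ _ => Nat.zero_le _) (Finset.mem_univ i)
      have h4 := hmv b hbF
      simp only [Finsupp.tsub_apply, hub, h4] at h1
      simp only [N] at h1
      omega
    · rfl
  rw [htop] at hle
  have := hle (Submodule.mem_top (x := Ideal.Quotient.mk _ (monomial m 1)))
  rw [LinearMap.mem_ker, LinearMap.comp_apply, (hφ m hms).1] at this
  simp at this

end Alg

/-- A small maximal independent set. -/
def smallMax (n : ℕ) (hn : 1 ≤ n) : Finset (Fin n × Fin 2) :=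
  (Finset.range ((n + 2) / 3)).image
    (fun t => ((⟨min (3 * t + 1) (n - 1), by omega⟩, 0) : Fin n × Fin 2))

/-- For every integer `n ≥ 1`,
`sdepth(I(P_{n,2})) > sdepth(S_{n,2}/I(P_{n,2})) = ⌈n/3⌉`. -/
theorem sdepth_edgeIdeal_P_n_2_gt (K : Type) [Field K] (n : ℕ) (hn : 1 ≤ n) :
    sdepth K (Fin n × Fin 2) (edgeIdeal K (pAdj n 2)) >
      sdepth K (Fin n × Fin 2)
        (MvPolynomial (Fin n × Fin 2) K ⧸ edgeIdeal K (pAdj n 2)) ∧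
    sdepth K (Fin n × Fin 2)
        (MvPolynomial (Fin n × Fin 2) K ⧸ edgeIdeal K (pAdj n 2)) = (n + 2) / 3 := by
  have hA : ∀ a b : Fin n × Fin 2, pAdj n 2 a b → a ≠ b := fun a b h => h.1
  have hle : sdepth K (Fin n × Fin 2)
      (MvPolynomial (Fin n × Fin 2) K ⧸ edgeIdeal K (pAdj n 2)) ≤ (n + 2) / 3 := by
    refine (sdepth_quot_le (pAdj n 2) hA (smallMax n hn) ?_ ?_).trans
      (Finset.card_image_le.trans (by simp))
    · rintro ⟨a, ha, b, hb, h⟩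
      obtain ⟨s, hs, rfl⟩ := Finset.mem_image.1 ha
      obtain ⟨t, ht, rfl⟩ := Finset.mem_image.1 hb
      rw [Finset.mem_range] at hs ht
      rw [pAdj_iff] at h
      obtain ⟨h1, h2, h3⟩ := h
      simp only at h2 h3
      have : s = t := by omega
      exact h1 (by rw [this])
    · intro v hv
      have hvn := v.1.2
      have hmem : ((⟨min (3 * ((v.1 : ℕ) / 3) + 1) (n - 1), by omega⟩, 0) : Fin n × Fin 2) ∈
          smallMax n hn :=
        Finset.mem_image.2 ⟨(v.1 : ℕ) / 3, Finset.mem_range.2 (by omega), rfl⟩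
      refine ⟨_, hmem, ?_⟩
      rw [pAdj_iff]
      refine ⟨?_, ?_, ?_⟩
      · intro h; exact hv (h ▸ hmem)
      · simp only; omega
      · simp only; omega
  have hge : (n + 2) / 3 ≤ sdepth K (Fin n × Fin 2)
      (MvPolynomial (Fin n × Fin 2) K ⧸ edgeIdeal K (pAdj n 2)) := by
    apply sdepth_quot_ge (pAdj n 2) hA
    have := part_IndF n n le_rfl
    convert this using 1
    ext T
    simp [IndF, DepS]
  have hI : (n + 2) / 3 + 1 ≤ sdepth K (Fin n × Fin 2) (edgeIdeal K (pAdj n 2)) := by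
    apply sdepth_ideal_ge (pAdj n 2) hA
    · have := part_DepF n n le_rfl
      convert this using 1
      ext T
      simp [DepF, DepS]
    · refine ⟨Finset.univ, (⟨0, hn⟩, 0), by simp, (⟨0, hn⟩, 1), by simp, ?_⟩
      rw [pAdj_iff]
      simp
  exact ⟨by omega, by omega⟩
end
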